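/- arXiv:2101.07590 — 11 statements merged into one kernel-verified Lean document; each statement's English description precedes it below -/
import Mathlib

section
/- For every positive integer k, if a simple graph G on n vertices contains no cycle of length exactly 2k, then G has at most 17·k·n^{1+1/k} edges. -/
open Finset in
/-- A graph with more than `c * #S` edges, all inside `S`, has a nonempty subgraph whose
non-isolated vertices all have degree more than `c`. -/
theorem SimpleGraph.exists_le_forall_adj_lt_degree {V : Type*} [Fintype V] (c : ℝ) (hc : 0 ≤ c)
    (H : SimpleGraph V) [DecidableRel H.Adj] (S : Finset V) (hS : ∀ a b, H.Adj a b → a ∈ S)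
    (hcard : c * #S < #H.edgeFinset) :
    ∃ K : SimpleGraph V, K ≤ H ∧ (∃ a b, K.Adj a b) ∧
      ∀ a b, K.Adj a b → c < (K.neighborSet a).ncard := by
  classical
  induction hn : #S using Nat.strong_induction_on generalizing S H with
  | _ n ih =>
    subst hn
    by_cases hdeg : ∀ a b, H.Adj a b → c < (H.neighborSet a).ncard
    · refine ⟨H, le_rfl, ?_, hdeg⟩
      by_contra! hno
      have hpos : (0 : ℝ) < #H.edgeFinset := lt_of_le_of_lt (by positivity) hcard
      obtain ⟨e, he⟩ := card_pos.mp (Nat.cast_pos.mp hpos)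
      induction e with
      | _ a b => exact hno a b (mem_edgeFinset.mp he)
    · push Not at hdeg
      obtain ⟨a, b, hab, hle⟩ := hdeg
      have haS := hS a b hab
      have hpos : 0 < #S := card_pos.mpr ⟨a, haS⟩
      have hdega : (H.neighborSet a).ncard = H.degree a := by
        rw [← card_neighborFinset_eq_degree, ← Set.ncard_coe_finset, coe_neighborFinset]
      have hE := card_edgeFinset_deleteIncidenceSet H a
      obtain ⟨K, hK, hne, hKdeg⟩ := ih (#(S.erase a)) (card_erase_lt_of_mem haS)
        (H.deleteIncidenceSet a) (S.erase a)
        (fun x y hxy => by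
          rw [deleteIncidenceSet_adj] at hxy
          exact mem_erase.mpr ⟨hxy.2.1, hS _ _ hxy.1⟩)
        (by
          have h1 : #H.edgeFinset ≤ #(H.deleteIncidenceSet a).edgeFinset + H.degree a := by
            omega
          have h2 : (#H.edgeFinset : ℝ) ≤ #(H.deleteIncidenceSet a).edgeFinset + H.degree a := by
            exact_mod_cast h1
          rw [card_erase_of_mem haS, Nat.cast_sub hpos]
          rw [hdega] at hle
          push_cast
          linarith) rfl
      exact ⟨K, hK.trans (deleteIncidenceSet_le H a), hne, hKdeg⟩

/-- Closing up a path through the ancestors of its ends: if the ends of a path lie on its lowest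
level and their ancestor lines first meet after `h + 1` steps, there is a cycle consisting of the
path and the two ancestor lines. -/
theorem SimpleGraph.exists_isCycle_of_iterate_parent_eq {V : Type*} (G : SimpleGraph V)
    (lev : V → ℕ∞) (par : V → V)
    (hpar : ∀ (i : ℕ) v, lev v = (i + 1 : ℕ) → lev (par v) = i ∧ G.Adj v (par v))
    (h i : ℕ) {u v : V} (p : G.Walk u v) (hp : p.IsPath)
    (hlev : ∀ z ∈ p.support, ((i + h + 1 : ℕ) : ℕ∞) ≤ lev z)
    (hu : lev u = (i + h + 1 : ℕ)) (hv : lev v = (i + h + 1 : ℕ))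
    (heq : par^[h + 1] u = par^[h + 1] v) (hne : par^[h] u ≠ par^[h] v) :
    ∃ (w : V) (c : G.Walk w w), c.IsCycle ∧ c.length = p.length + 2 * (h + 1) := by
  induction h generalizing u v with
  | zero =>
    obtain ⟨hlu, hau⟩ := hpar _ u hu
    obtain ⟨hlv, hav⟩ := hpar _ v hv
    simp only [zero_add, Function.iterate_one, Function.iterate_zero, id] at heq hne
    have hnot : par v ∉ p.support := fun hm => by
      have := hlev _ hm
      rw [hlv, Nat.cast_le] at this
      omega
    rw [heq] at hau
    refine ⟨v, .cons hav (.cons hau.symm p), ?_, by simp⟩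
    rw [Walk.cons_isCycle_iff, Walk.cons_isPath_iff]
    refine ⟨⟨hp, hnot⟩, fun hm => ?_⟩
    rw [Walk.edges_cons, List.mem_cons] at hm
    rcases hm with hm | hm
    · rw [Sym2.eq_swap, Sym2.congr_right] at hm
      exact hne hm.symm
    · exact hnot (Walk.snd_mem_support_of_mem_edges _ hm)
  | succ h ih =>
    obtain ⟨hlu, hau⟩ := hpar _ u hu
    obtain ⟨hlv, hav⟩ := hpar _ v hv
    have hnot : ∀ z, lev z = (i + (h + 1) : ℕ) → z ∉ p.support := fun z hz hm => by
      have := hlev _ hm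
      rw [hz, Nat.cast_le] at this
      omega
    have hne' : par u ≠ par v := fun hc => hne (by rw [Function.iterate_succ_apply, hc]; rfl)
    obtain ⟨w, c, hc, hcl⟩ := ih (.cons hau.symm (p.concat hav))
      (by
        rw [Walk.cons_isPath_iff, Walk.concat_isPath_iff, Walk.support_concat]
        simp only [List.mem_append, List.mem_singleton]
        exact ⟨⟨hp, hnot _ hlv⟩, fun hm => hm.elim (hnot _ hlu) hne'⟩)
      (by
        intro z hz
        rw [Walk.support_cons, Walk.support_concat] at hz
        simp only [List.mem_cons, List.mem_append, List.not_mem_nil, or_false] at hz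
        rcases hz with rfl | hz | rfl
        · exact hlu.ge
        · exact le_trans (by rw [Nat.cast_le]; omega) (hlev z hz)
        · exact hlv.ge)
      hlu hlv heq hne
    refine ⟨w, c, hc, ?_⟩
    rw [hcl, Walk.length_cons, Walk.length_concat]
    ring

/-- Greedy extension: in a graph whose non-isolated vertices have large degree, every
non-isolated vertex starts a path of prescribed length avoiding a given small set. -/
theorem SimpleGraph.exists_isPath_avoiding {V : Type*} [Finite V] (H : SimpleGraph V) (D : ℕ)
    (hdeg : ∀ a b, H.Adj a b → D ≤ (H.neighborSet a).ncard) (l : ℕ) {w : V} (X : Finset V)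
    (hw : ∃ b, H.Adj w b) (hwX : w ∉ X) (hX : X.card + l < D) :
    ∃ (v : V) (p : H.Walk w v), p.IsPath ∧ p.length = l ∧ (∀ z ∈ p.support, z ∉ X) ∧
      ∀ z ∈ p.support, ∃ b, H.Adj z b := by
  classical
  induction l generalizing w X with
  | zero => exact ⟨w, .nil, by simp, rfl, by simpa using hwX, by simpa using hw⟩
  | succ l ih =>
    obtain ⟨b, hb⟩ := hw
    obtain ⟨x, hx, hxX⟩ : ∃ x, H.Adj w x ∧ x ∉ (X : Set V) := by
      by_contra! hsub
      have h1 := Set.ncard_le_ncard (s := H.neighborSet w) (t := (X : Set V)) hsub X.finite_toSet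
      rw [Set.ncard_coe_finset] at h1
      have := hdeg w b hb
      omega
    obtain ⟨v, p, hp, hl, hav, hsup⟩ := ih (w := x) (insert w X) ⟨w, hx.symm⟩
      (by
        rw [Finset.mem_insert, not_or]
        exact ⟨hx.ne', hxX⟩)
      (by have := Finset.card_insert_le w X; omega)
    refine ⟨v, .cons hx p, ?_, by simp [hl], ?_, ?_⟩
    · rw [Walk.cons_isPath_iff]
      exact ⟨hp, fun hm => hav w hm (Finset.mem_insert_self _ _)⟩
    · intro z hz
      rw [Walk.support_cons, List.mem_cons] at hz
      rcases hz with rfl | hz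
      · exact hwX
      · exact fun h => hav z hz (Finset.mem_insert_of_mem h)
    · intro z hz
      rw [Walk.support_cons, List.mem_cons] at hz
      rcases hz with rfl | hz
      · exact ⟨b, hb⟩
      · exact hsup z hz

/-- A function which agrees on the ends of two-step walks starting in `P` agrees on the ends of
walks of even length starting in `P`. -/
theorem SimpleGraph.Walk.apply_eq_of_length_even {V α : Type*} {H : SimpleGraph V}
    {P : V → Prop} {f : V → α}
    (hf : ∀ u w u', H.Adj u w → H.Adj w u' → P u → P u' ∧ f u = f u') (m : ℕ) {u v : V}
    (p : H.Walk u v) (hp : p.length = 2 * m) (hu : P u) : P v ∧ f u = f v := by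
  induction m generalizing u with
  | zero =>
    obtain rfl := Walk.eq_of_length_eq_zero hp
    exact ⟨hu, rfl⟩
  | succ m ih =>
    match p, hp with
    | .cons h₁ (.cons h₂ q), hp =>
      obtain ⟨hu', he⟩ := hf _ _ _ h₁ h₂ hu
      obtain ⟨hv, he'⟩ := ih q (by simp only [Walk.length_cons] at hp; omega) hu'
      exact ⟨hv, he.trans he'⟩

/-- In a graph without cycles of length `2 * k`, a subgraph `H` living on the levels from `i < k`
on, whose walks of length two starting on level `i` end there, has a vertex of degree at most
`2 * k`. -/
theorem SimpleGraph.exists_degree_le_of_levels {V : Type*} [Finite V] (G : SimpleGraph V)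
    (k : ℕ) (hfree : ∀ (v : V) (w : G.Walk v v), w.IsCycle → w.length ≠ 2 * k)
    (x : V) (lev : V → ℕ∞) (hlev : ∀ v, lev v = 0 → v = x) (par : V → V)
    (hpar : ∀ (i : ℕ) v, lev v = (i + 1 : ℕ) → lev (par v) = i ∧ G.Adj v (par v))
    (i : ℕ) (hi : i < k) (H : SimpleGraph V) (hH : H ≤ G)
    (hge : ∀ a b, H.Adj a b → (i : ℕ∞) ≤ lev a)
    (htwo : ∀ a b c, H.Adj a b → H.Adj b c → lev a = i → lev c = i)
    (hmem : ∀ a b, H.Adj a b → lev a = i ∨ lev b = i) (hne : ∃ a b, H.Adj a b) :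
    ∃ a b, H.Adj a b ∧ (H.neighborSet a).ncard ≤ 2 * k := by
  classical
  by_contra! hdeg
  have key : ∀ j ≤ i, ∀ u w u', H.Adj u w → H.Adj w u' → lev u = i →
      par^[i - j] u = par^[i - j] u' := by
    intro j
    induction j with
    | zero =>
      intro _ u w u' huw hwu hu
      have root : ∀ (n : ℕ) v, lev v = n → par^[n] v = x := by
        intro n
        induction n with
        | zero => exact fun v hv => hlev v hv
        | succ n ih =>
          intro v hv
          exact ih _ (hpar n v hv).1
      rw [Nat.sub_zero, root i u hu, root i u' (htwo _ _ _ huw hwu hu)]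
    | succ j ih =>
      intro hj u w u' huw hwu hu
      have hu' := htwo _ _ _ huw hwu hu
      obtain ⟨h, rfl⟩ : ∃ h, i = j + h + 1 := ⟨i - (j + 1), by omega⟩
      have hsub : j + h + 1 - (j + 1) = h := by omega
      have hsub' : j + h + 1 - j = h + 1 := by omega
      rw [hsub]
      rw [hsub'] at ih
      obtain ⟨m, rfl⟩ : ∃ m, k = m + 1 + (h + 1) := ⟨k - (h + 2), by omega⟩
      obtain ⟨v, p, hp, hpl, hav, hsup⟩ := H.exists_isPath_avoiding _
        (fun a b hab => hdeg a b hab) (2 * m + 1) (w := w) {u, u'} ⟨u, huw.symm⟩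
        (by simp [huw.ne', hwu.ne])
        (by have := Finset.card_le_two (a := u) (b := u'); omega)
      have hto : ∀ t, H.Adj t w → lev t = (j + h + 1 : ℕ) → t ∉ p.support →
          par^[h] t = par^[h] v := by
        intro t ht hlt htp
        obtain ⟨hlv, he⟩ := Walk.apply_eq_of_length_even (P := fun a => lev a = (j + h + 1 : ℕ))
          (f := par^[h + 1])
          (fun a b c hab hbc ha => ⟨htwo a b c hab hbc ha, ih (by omega) a b c hab hbc ha⟩)
          (m + 1) (.cons ht p) (by rw [Walk.length_cons, hpl]; ring) hlt
        by_contra hneq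
        obtain ⟨y, c, hc, hcl⟩ := G.exists_isCycle_of_iterate_parent_eq lev par hpar h j
          ((Walk.cons ht p).mapLe hH)
          ((Walk.isPath_mapLe hH).mpr ((Walk.cons_isPath_iff _ _).mpr ⟨hp, htp⟩))
          (by
            intro z hz
            rw [Walk.support_mapLe_eq_support, Walk.support_cons, List.mem_cons] at hz
            rcases hz with rfl | hz
            · exact hlt.ge
            · obtain ⟨b, hb⟩ := hsup z hz
              exact hge z b hb)
          hlt hlv he hneq
        refine hfree y c hc ?_
        rw [hcl, Walk.length_mapLe, Walk.length_cons, hpl]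
        ring
      rw [hto u huw hu fun hm => hav u hm (by simp),
        hto u' hwu.symm hu' fun hm => hav u' hm (by simp)]
  obtain ⟨w, u, hwu, hu⟩ : ∃ w u, H.Adj w u ∧ lev u = i := by
    obtain ⟨a, b, hab⟩ := hne
    rcases hmem a b hab with h | h
    · exact ⟨b, a, hab.symm, h⟩
    · exact ⟨a, b, hab, h⟩
  have hsub : H.neighborSet w ⊆ {u} := fun u' hu' => by
    have := key i le_rfl u w u' hwu.symm hu' hu
    simpa using this.symm
  have := Set.ncard_le_ncard hsub (Set.finite_singleton u)
  rw [Set.ncard_singleton] at this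
  have := hdeg w u hwu
  omega

/-- The subgraph of all edges between level `i` and level `j` of a graph with a level function. -/
def SimpleGraph.levelGraph {V : Type*} (G : SimpleGraph V) (lev : V → ℕ∞) (i j : ℕ) :
    SimpleGraph V where
  Adj a b := G.Adj a b ∧ (lev a = i ∧ lev b = j ∨ lev a = j ∧ lev b = i)
  symm := ⟨fun _ _ h => ⟨h.1.symm, h.2.symm.imp And.symm And.symm⟩⟩
  loopless := ⟨fun _ h => h.1.ne rfl⟩

theorem SimpleGraph.levelGraph_adj {V : Type*} {G : SimpleGraph V} {lev : V → ℕ∞} {i j : ℕ}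
    {a b : V} : (G.levelGraph lev i j).Adj a b ↔
      G.Adj a b ∧ (lev a = i ∧ lev b = j ∨ lev a = j ∧ lev b = i) :=
  Iff.rfl

open Finset in
/-- In a graph without cycles of length `2 * k`, there are few edges between equal or consecutive
levels. -/
theorem SimpleGraph.card_edgeFinset_levelGraph_le {V : Type*} [Fintype V] (G : SimpleGraph V)
    (k : ℕ) (hfree : ∀ (v : V) (w : G.Walk v v), w.IsCycle → w.length ≠ 2 * k)
    (x : V) (lev : V → ℕ∞) (hlev : ∀ v, lev v = 0 → v = x) (par : V → V)
    (hpar : ∀ (i : ℕ) v, lev v = (i + 1 : ℕ) → lev (par v) = i ∧ G.Adj v (par v))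
    (i j : ℕ) (hi : i < k) (hij : j = i ∨ j = i + 1) (S : Finset V)
    (hS : ∀ v, lev v = i ∨ lev v = j → v ∈ S) [DecidableRel (G.levelGraph lev i j).Adj] :
    #(G.levelGraph lev i j).edgeFinset ≤ 2 * k * #S := by
  by_contra! hlt
  obtain ⟨K, hK, hne, hdeg⟩ := exists_le_forall_adj_lt_degree (2 * k : ℝ) (by positivity)
    (G.levelGraph lev i j) S (fun a b hab => hS a (hab.2.imp And.left And.left))
    (by exact_mod_cast hlt)
  obtain ⟨a, b, hab, hle⟩ := G.exists_degree_le_of_levels k hfree x lev hlev par hpar i hi K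
    (fun a b hab => (hK hab).1)
    (fun a b hab => by
      rcases (hK hab).2 with ⟨h, -⟩ | ⟨h, -⟩
      · exact h.ge
      · rw [h, Nat.cast_le]
        omega)
    (fun a b c hab hbc ha => by
      have h₁ := (hK hab).2
      have h₂ := (hK hbc).2
      rcases hij with rfl | rfl
      · exact h₂.elim And.right And.right
      · have hne : ((i : ℕ) : ℕ∞) ≠ (i + 1 : ℕ) := by
          rw [Ne, Nat.cast_inj]
          omega
        rcases h₁ with ⟨-, hb⟩ | ⟨ha', -⟩
        · rcases h₂ with ⟨hb', -⟩ | ⟨-, hc⟩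
          · exact absurd (hb'.symm.trans hb) hne
          · exact hc
        · exact absurd (ha.symm.trans ha') hne)
    (fun a b hab => (hK hab).2.imp And.left And.right) hne
  have := hdeg a b hab
  norm_cast at this
  omega

open Finset in
/-- A graph without cycles of length `2 * k` in which all non-isolated vertices have degree more
than `17 * k * N` has more than `N ^ k` vertices, unless it has no edges. -/
theorem SimpleGraph.pow_lt_card_of_lt_degree {V : Type*} [Fintype V] (G : SimpleGraph V)
    (k : ℕ) (hk : 0 < k) (hfree : ∀ (v : V) (w : G.Walk v v), w.IsCycle → w.length ≠ 2 * k)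
    (N : ℝ) (hN : 1 ≤ N) (hne : ∃ a b, G.Adj a b)
    (hdeg : ∀ a b, G.Adj a b → 17 * k * N < (G.neighborSet a).ncard) :
    N ^ k < Fintype.card V := by
  classical
  obtain ⟨x, y, hxy⟩ := hne
  obtain ⟨lev, hlevdef⟩ : ∃ lev : V → ℕ∞, ∀ v, lev v = G.edist x v := ⟨_, fun _ => rfl⟩
  have hlev0 : ∀ v, lev v = 0 → v = x := fun v hv => by
    rw [hlevdef, edist_eq_zero_iff] at hv
    exact hv.symm
  have hstep : ∀ u v, G.Adj u v → lev v ≤ lev u + 1 := fun u v huv => by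
    rw [hlevdef, hlevdef, ← edist_eq_one_iff_adj.mpr huv]
    exact G.edist_triangle
  have hparent : ∀ v, ∃ u, ∀ i : ℕ, lev v = (i + 1 : ℕ) → lev u = i ∧ G.Adj v u := by
    intro v
    by_cases h : ∃ i : ℕ, lev v = (i + 1 : ℕ)
    · obtain ⟨i, hi⟩ := h
      obtain ⟨p, hp⟩ := exists_walk_of_edist_eq_coe ((hlevdef v).symm.trans hi)
      have hnil : ¬ p.Nil := fun hn => by
        rw [← Walk.length_eq_zero_iff] at hn
        omega
      refine ⟨p.penultimate, fun i' hi' => ?_⟩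
      obtain rfl : i = i' := by
        rw [hi, Nat.cast_inj] at hi'
        omega
      have hadj := p.adj_penultimate hnil
      refine ⟨le_antisymm ?_ ?_, hadj.symm⟩
      · rw [hlevdef]
        refine (edist_le p.dropLast).trans ?_
        rw [Nat.cast_le]
        have := Walk.length_dropLast_add_one hnil
        omega
      · have := hstep _ _ hadj
        rw [hi, Nat.cast_add, Nat.cast_one] at this
        exact (ENat.add_le_add_iff_right ENat.one_ne_top).mp this
    · exact ⟨v, fun i hi => absurd ⟨i, hi⟩ h⟩
  choose par hpar' using hparent
  have hpar : ∀ (i : ℕ) v, lev v = (i + 1 : ℕ) → lev (par v) = i ∧ G.Adj v (par v) :=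
    fun i v => hpar' v i
  obtain ⟨L, hL⟩ : ∃ L : ℕ → Finset V, ∀ i v, v ∈ L i ↔ lev v = i :=
    ⟨fun i => univ.filter fun v => lev v = i, fun i v => by simp⟩
  have hncard : ∀ v, (G.neighborSet v).ncard = G.degree v := fun v => by
    rw [← card_neighborFinset_eq_degree, ← Set.ncard_coe_finset, coe_neighborFinset]
  have hwithin : ∀ i < k, #(G.levelGraph lev i i).edgeFinset ≤ 2 * k * #(L i) := fun i hi =>
    G.card_edgeFinset_levelGraph_le k hfree x lev hlev0 par hpar i i hi (.inl rfl) (L i)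
      (by simp [hL])
  have hcross : ∀ i < k, #(G.levelGraph lev i (i + 1)).edgeFinset
      ≤ 2 * k * (#(L i) + #(L (i + 1))) := fun i hi =>
    (G.card_edgeFinset_levelGraph_le k hfree x lev hlev0 par hpar i (i + 1) hi (.inr rfl)
      (L i ∪ L (i + 1)) (by simp [hL])).trans (Nat.mul_le_mul_left _ (card_union_le _ _))
  have hbip : ∀ i, (G.levelGraph lev i (i + 1)).IsBipartiteWith (L i) (L (i + 1)) := fun i => by
    refine ⟨?_, fun a b hab => ?_⟩
    · rw [Finset.disjoint_coe, Finset.disjoint_left]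
      intro v h₁ h₂
      rw [hL] at h₁ h₂
      rw [h₁, Nat.cast_inj] at h₂
      omega
    · simpa only [mem_coe, hL] using hab.2
  have hsum : ∀ i, ∑ v ∈ L (i + 1), G.degree v ≤ 2 * #(G.levelGraph lev (i + 1) (i + 1)).edgeFinset
      + #(G.levelGraph lev i (i + 1)).edgeFinset
      + #(G.levelGraph lev (i + 1) (i + 1 + 1)).edgeFinset := by
    intro i
    rw [← sum_degrees_eq_twice_card_edges, ← isBipartiteWith_sum_degrees_eq_card_edges' (hbip i),
      ← isBipartiteWith_sum_degrees_eq_card_edges (hbip (i + 1))]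
    refine le_trans ?_ (Nat.add_le_add_right (Nat.add_le_add_right
      (sum_le_sum_of_subset (subset_univ (L (i + 1)))) _) _)
    rw [← sum_add_distrib, ← sum_add_distrib]
    refine sum_le_sum fun v hv => ?_
    rw [hL] at hv
    simp only [← card_neighborFinset_eq_degree]
    refine le_trans (card_le_card ?_) ((card_union_le _ _).trans
      (Nat.add_le_add_right (card_union_le _ _) _))
    intro u hu
    rw [mem_neighborFinset] at hu
    simp only [mem_union, mem_neighborFinset, levelGraph_adj, hv, hu, true_and]
    have h₁ := hstep _ _ hu
    have h₂ := hstep _ _ hu.symm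
    rw [hv] at h₁ h₂
    have htop : lev u ≠ ⊤ := fun h => by
      rw [h, top_le_iff] at h₁
      exact absurd h₁ (by simp)
    obtain ⟨n, hn⟩ := ENat.ne_top_iff_exists.mp htop
    rw [← hn] at h₁ h₂ ⊢
    norm_cast at h₁ h₂ ⊢
    omega
  have hfirst : N < #(L 1) := by
    have hx : G.neighborFinset x ⊆ L 1 := fun u hu => by
      rw [mem_neighborFinset] at hu
      rw [hL, hlevdef, edist_eq_one_iff_adj.mpr hu, Nat.cast_one]
    have h₁ := hdeg x y hxy
    have h₂ : (G.degree x : ℝ) ≤ #(L 1) := by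
      rw [← card_neighborFinset_eq_degree]
      exact_mod_cast card_le_card hx
    rw [hncard] at h₁
    have h₃ : (1 : ℝ) ≤ k := by exact_mod_cast hk
    nlinarith
  have hzero : #(L 0) ≤ 1 := card_le_one.mpr fun a ha b hb => by
    rw [hL, Nat.cast_zero] at ha hb
    rw [hlev0 a ha, hlev0 b hb]
  have hgrow : ∀ i < k, N ^ (i + 1) < #(L (i + 1)) ∧ (#(L i) : ℝ) ≤ #(L (i + 1)) := by
    intro i
    induction i with
    | zero =>
      intro _
      rw [zero_add, pow_one]
      have : (#(L 0) : ℝ) ≤ 1 := by exact_mod_cast hzero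
      exact ⟨hfirst, by linarith⟩
    | succ i ih =>
      intro hi
      obtain ⟨h₁, h₂⟩ := ih (by omega)
      have hlow : (17 * k * N) * #(L (i + 1)) ≤ ∑ v ∈ L (i + 1), (G.degree v : ℝ) := by
        rw [mul_comm, ← nsmul_eq_mul]
        refine card_nsmul_le_sum _ _ _ fun v hv => ?_
        rw [← hncard]
        exact (hdeg v _ (hpar i v ((hL _ _).mp hv)).2).le
      have hup : (∑ v ∈ L (i + 1), G.degree v) ≤ 2 * (2 * k * #(L (i + 1)))
          + 2 * k * (#(L i) + #(L (i + 1))) + 2 * k * (#(L (i + 1)) + #(L (i + 1 + 1))) := by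
        have := hsum i
        have := hwithin (i + 1) hi
        have := hcross i (by omega)
        have := hcross (i + 1) hi
        omega
      have hup' : (∑ v ∈ L (i + 1), (G.degree v : ℝ)) ≤ 2 * (2 * k * #(L (i + 1)))
          + 2 * k * (#(L i) + #(L (i + 1))) + 2 * k * (#(L (i + 1)) + #(L (i + 1 + 1))) := by
        exact_mod_cast hup
      have hk' : (0 : ℝ) < k := by exact_mod_cast hk
      have hboth : 17 * N * #(L (i + 1)) ≤ 10 * #(L (i + 1)) + 2 * #(L (i + 1 + 1)) := by
        refine le_of_mul_le_mul_left ?_ hk'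
        nlinarith
      have hpos : (0 : ℝ) ≤ #(L (i + 1)) := by positivity
      have hratio : N * #(L (i + 1)) ≤ #(L (i + 1 + 1)) := by nlinarith
      refine ⟨?_, by nlinarith⟩
      rw [pow_succ']
      exact (mul_lt_mul_of_pos_left h₁ (by linarith)).trans_le hratio
  obtain ⟨k, rfl⟩ : ∃ m, k = m + 1 := ⟨k - 1, by omega⟩
  refine (hgrow k (by omega)).1.trans_le ?_
  exact_mod_cast card_le_univ _

/-- **Turán number of C_{2k}.** If a simple graph `G` on `n` vertices contains no
cycle of length exactly `2k` (for `k ≥ 1`), then `G` has at most `17 · k · n^{1+1/k}` edges. -/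
theorem turan_even_cycle {V : Type*} [Fintype V] [DecidableEq V]
    (G : SimpleGraph V) [DecidableRel G.Adj] (k : ℕ) (hk : 0 < k)
    (hfree : ∀ (v : V) (w : G.Walk v v), w.IsCycle → w.length ≠ 2 * k) :
    (G.edgeFinset.card : ℝ) ≤
      17 * k * (Fintype.card V : ℝ) ^ ((1 : ℝ) + 1 / k) := by
  by_contra! hlt
  rcases isEmpty_or_nonempty V with hV | hV
  · have hcard : G.edgeFinset.card = 0 := by
      rw [Finset.card_eq_zero, Finset.eq_empty_iff_forall_notMem]
      exact fun e => e.ind fun a => isEmptyElim a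
    rw [hcard, Nat.cast_zero] at hlt
    exact absurd hlt (not_lt.mpr (by positivity))
  have hn : (1 : ℝ) ≤ Fintype.card V := by exact_mod_cast Fintype.card_pos
  rw [Real.rpow_add (by linarith), Real.rpow_one] at hlt
  obtain ⟨K, hK, hne, hdeg⟩ := G.exists_le_forall_adj_lt_degree
    (17 * k * (Fintype.card V : ℝ) ^ ((1 : ℝ) / k)) (by positivity) Finset.univ (by simp)
    (by rw [Finset.card_univ]; linarith)
  have hpow := K.pow_lt_card_of_lt_degree k hk
    (fun v w hw => by
      rw [← SimpleGraph.Walk.length_mapLe hK w]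
      exact hfree v _ ((SimpleGraph.Walk.isCycle_mapLe hK).mpr hw))
    _ (Real.one_le_rpow hn (by positivity)) hne hdeg
  rw [← Real.rpow_natCast, ← Real.rpow_mul (by linarith),
    one_div_mul_cancel (by positivity), Real.rpow_one] at hpow
  exact lt_irrefl _ hpow
end

section
/- For every positive integer k, if a simple graph G on n vertices contains no cycle of length i for every i with 3 ≤ i ≤ 2k (equivalently, the girth of G is greater than 2k), then G has at most n^{1+1/k} + n edges. -/
namespace SimpleGraph

variable {V : Type*} {G : SimpleGraph V} {k : ℕ}

/-- Paths of length at most `k` are determined by their endpoints if the girth exceeds `2 * k`. -/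
lemma Walk.IsPath.eq_of_lt_egirth (hG : ((2 * k : ℕ) : ℕ∞) < G.egirth) {u v : V}
    {p q : G.Walk u v} (hp : p.IsPath) (hq : q.IsPath) (hpk : p.length ≤ k)
    (hqk : q.length ≤ k) : p = q := by
  by_contra hpq
  obtain ⟨w, -, -, c, hc, hlen⟩ := hp.exists_isCycle_length_le_add_of_ne hq hpq
  have h : 2 * k < c.length := by exact_mod_cast hG.trans_le (egirth_le_length hc)
  omega

/-- If the girth exceeds `2 * k`, a path of length less than `k` can be extended at its start by
every neighbour of the start other than its second vertex. -/
lemma Walk.IsPath.cons_of_lt_egirth (hG : ((2 * k : ℕ) : ℕ∞) < G.egirth) {u v w : V}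
    {p : G.Walk u v} (hp : p.IsPath) (hpk : p.length < k) (h : G.Adj w u) (hw : w ≠ p.snd) :
    (cons h p).IsPath := by
  classical
  refine hp.cons fun hmem ↦ hw ?_
  have hlen := p.length_takeUntil_le_length hmem
  have heq : p.takeUntil w hmem = h.symm.toWalk :=
    (hp.takeUntil hmem).eq_of_lt_egirth hG (.of_adj h.symm) (by omega)
      (by simp; omega)
  rw [← snd_takeUntil h.ne p hmem, heq]
  simp

variable [Fintype V] [DecidableRel G.Adj]

/-- The Moore bound: a nonempty graph with minimum degree at least `d + 1` and girth exceeding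
`2 * k` has at least `d ^ k` vertices. -/
lemma pow_le_card_of_lt_egirth [Nonempty V] (hG : ((2 * k : ℕ) : ℕ∞) < G.egirth) {d : ℕ}
    (hd : ∀ v, d + 1 ≤ G.degree v) : d ^ k ≤ Fintype.card V := by
  classical
  obtain ⟨v⟩ := ‹Nonempty V›
  let E (i : ℕ) : Finset V := {u | ∃ p : G.Walk u v, p.IsPath ∧ p.length = i}
  suffices ∀ i ≤ k, d ^ i ≤ (E i).card from (this k le_rfl).trans (Finset.card_le_univ _)
  intro i
  induction i with
  | zero =>
    intro _
    exact Finset.card_pos.2 ⟨v, by simp [E]⟩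
  | succ i ih =>
    intro hi
    have hpath (u : E i) : ∃ p : G.Walk u v, p.IsPath ∧ p.length = i := by
      exact (Finset.mem_filter.1 u.2).2
    choose P hP hPlen using hpath
    let N (u : E i) : Finset V := (G.neighborFinset u).erase (P u).snd
    have hcons {u : E i} {w : V} (hw : w ∈ N u) :
        ∃ h : G.Adj w u, (Walk.cons h (P u)).IsPath := by
      obtain ⟨hne, hadj⟩ := Finset.mem_erase.1 hw
      have hadj : G.Adj w u := ((G.mem_neighborFinset _ _).1 hadj).symm
      exact ⟨hadj, (hP u).cons_of_lt_egirth hG (by rw [hPlen]; omega) hadj hne⟩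
    have hdisj : ((Finset.univ : Finset (E i)) : Set (E i)).PairwiseDisjoint N := by
      intro u₁ _ u₂ _ hne
      refine Finset.disjoint_left.2 fun w hw₁ hw₂ ↦ hne ?_
      obtain ⟨h₁, hp₁⟩ := hcons hw₁
      obtain ⟨h₂, hp₂⟩ := hcons hw₂
      have heq := hp₁.eq_of_lt_egirth hG hp₂ (by simp [hPlen, hi]) (by simp [hPlen, hi])
      exact Subtype.ext (by simpa using congrArg Walk.snd heq)
    have hsub : Finset.univ.biUnion N ⊆ E (i + 1) := by
      intro w hw
      obtain ⟨u, -, hu⟩ := Finset.mem_biUnion.1 hw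
      obtain ⟨h, hp⟩ := hcons hu
      simpa [E] using ⟨_, hp, by simp [hPlen]⟩
    have hN (u : E i) : d ≤ (N u).card :=
      (Nat.le_sub_of_add_le (hd u)).trans Finset.pred_card_le_card_erase
    calc d ^ (i + 1) ≤ (E i).card * d := by
          rw [pow_succ]
          exact Nat.mul_le_mul_right d (ih (by omega))
      _ = ∑ _u : E i, d := by simp
      _ ≤ ∑ u : E i, (N u).card := Finset.sum_le_sum fun u _ ↦ hN u
      _ = (Finset.univ.biUnion N).card := (Finset.card_biUnion hdisj).symm
      _ ≤ (E (i + 1)).card := Finset.card_le_card hsub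

/-- A nonempty graph on `n` vertices with girth exceeding `2 * k` has a vertex of degree at most
`n ^ (1 / k) + 1`. -/
lemma exists_degree_le_rpow_of_lt_egirth [Nonempty V] (hk : k ≠ 0)
    (hG : ((2 * k : ℕ) : ℕ∞) < G.egirth) :
    ∃ v, (G.degree v : ℝ) ≤ (Fintype.card V : ℝ) ^ ((1 : ℝ) / k) + 1 := by
  by_contra! h
  have hpos : (0 : ℝ) ≤ (Fintype.card V : ℝ) ^ ((1 : ℝ) / k) := by positivity
  obtain ⟨v, hv⟩ := G.exists_minimal_degree_vertex
  have hdeg : 1 ≤ G.degree v := by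
    have : (1 : ℝ) < G.degree v := by linarith [h v]
    exact_mod_cast this.le
  have hle := pow_le_card_of_lt_egirth (d := G.degree v - 1) hG fun u ↦ by
    have := G.minDegree_le_degree u
    omega
  have hlt : (Fintype.card V : ℝ) ^ ((1 : ℝ) / k) < (G.degree v - 1 : ℕ) := by
    rw [Nat.cast_sub hdeg]
    push_cast
    linarith [h v]
  have hlt' := pow_lt_pow_left₀ hlt hpos hk
  rw [one_div, Real.rpow_inv_natCast_pow (Nat.cast_nonneg _) hk] at hlt'
  exact hle.not_gt (by exact_mod_cast hlt')

/-- A graph on `n` vertices with girth exceeding `2 * k` has at most `n * (n ^ (1 / k) + 1)`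
edges. -/
lemma card_edgeFinset_le_of_lt_egirth (hk : k ≠ 0) (hG : ((2 * k : ℕ) : ℕ∞) < G.egirth) :
    (G.edgeFinset.card : ℝ) ≤
      Fintype.card V * ((Fintype.card V : ℝ) ^ ((1 : ℝ) / k) + 1) := by
  classical
  induction hn : Fintype.card V generalizing V with
  | zero =>
    have := Fintype.card_eq_zero_iff.1 hn
    simp [Subsingleton.elim G ⊥]
  | succ n ih =>
    have : Nonempty V := Fintype.card_pos_iff.1 (by omega)
    obtain ⟨v, hv⟩ := exists_degree_le_rpow_of_lt_egirth hk hG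
    have hcard := G.card_edgeFinset_deleteIncidenceSet v
    rw [← card_edgeFinset_induce_compl_singleton] at hcard
    have hind := ih (G := G.induce {v}ᶜ)
      (hG.trans_le (IsContained.egirth_le ⟨(Embedding.induce _).toCopy⟩))
      (by rw [Fintype.card_compl_set]; simp [hn])
    have hedges : (G.edgeFinset.card : ℝ) ≤
        (G.induce ({v}ᶜ : Set V)).edgeFinset.card + G.degree v := by
      exact_mod_cast (by omega)
    have hmono : (n : ℝ) ^ ((1 : ℝ) / k) ≤ ((n + 1 : ℕ) : ℝ) ^ ((1 : ℝ) / k) := by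
      gcongr
      omega
    rw [hn] at hv
    calc (G.edgeFinset.card : ℝ)
        ≤ n * ((n : ℝ) ^ ((1 : ℝ) / k) + 1) + (((n + 1 : ℕ) : ℝ) ^ ((1 : ℝ) / k) + 1) := by
          linarith
      _ ≤ n * (((n + 1 : ℕ) : ℝ) ^ ((1 : ℝ) / k) + 1)
          + (((n + 1 : ℕ) : ℝ) ^ ((1 : ℝ) / k) + 1) := by gcongr
      _ = ((n + 1 : ℕ) : ℝ) * (((n + 1 : ℕ) : ℝ) ^ ((1 : ℝ) / k) + 1) := by
          push_cast
          ring

end SimpleGraph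

/-- **Turán number for girth.** If a simple graph `G` on `n` vertices contains no cycle
of length `i` for every `3 ≤ i ≤ 2k` (i.e. the girth of `G` is greater than `2k`), then
`G` has at most `n^{1+1/k} + n` edges. -/
theorem turan_girth {V : Type*} [Fintype V] [DecidableEq V]
    (G : SimpleGraph V) [DecidableRel G.Adj] (k : ℕ) (hk : 0 < k)
    (hfree : ∀ i, 3 ≤ i → i ≤ 2 * k →
      ∀ (v : V) (w : G.Walk v v), w.IsCycle → w.length ≠ i) :
    (G.edgeFinset.card : ℝ) ≤
      (Fintype.card V : ℝ) ^ ((1 : ℝ) + 1 / k) + Fintype.card V := by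
  have hG : ((2 * k : ℕ) : ℕ∞) < G.egirth := by
    refine lt_of_lt_of_le (b := ((2 * k + 1 : ℕ) : ℕ∞)) (by exact_mod_cast Nat.lt_succ_self _) ?_
    refine SimpleGraph.le_egirth.2 fun v w hw ↦ ?_
    by_contra! hlt
    have hlt : w.length < 2 * k + 1 := by exact_mod_cast hlt
    exact hfree w.length hw.three_le_length (by omega) v w hw rfl
  refine (SimpleGraph.card_edgeFinset_le_of_lt_egirth hk.ne' hG).trans_eq ?_
  rw [Real.rpow_one_add' (Nat.cast_nonneg _) (by positivity)]
  ring
end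

section
/- For all integers n and k with 5 ≤ k and 2^k < n, the binomial coefficient C(⌈k·n^{2/k}/(20e)⌉, ⌊k/4⌋) is at most n, where e denotes Euler's number and n^{2/k} denotes the real power of n. -/
/-- The classical bound `C(N, m) ≤ (eN/m)^m`. -/
theorem choose_le_exp_mul_div_pow (N : ℕ) {m : ℕ} (hm : 0 < m) :
    (N.choose m : ℝ) ≤ (Real.exp 1 * N / m) ^ m := by
  have hm' : (0 : ℝ) < m := by exact_mod_cast hm
  have hexp : (m : ℝ) ^ m / m.factorial ≤ Real.exp 1 ^ m := by
    simpa [← Real.exp_nat_mul] using Real.pow_div_factorial_le_exp (m : ℝ) hm'.le m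
  calc (N.choose m : ℝ) ≤ (N : ℝ) ^ m / m.factorial := Nat.choose_le_pow_div m N
    _ = (N : ℝ) ^ m / (m : ℝ) ^ m * ((m : ℝ) ^ m / m.factorial) := by
      field_simp
    _ ≤ (N : ℝ) ^ m / (m : ℝ) ^ m * Real.exp 1 ^ m := by gcongr
    _ = (Real.exp 1 * N / m) ^ m := by rw [div_pow, mul_pow]; ring

/-- For integers `5 ≤ k` and `2^k < n`, the binomial coefficient
`C(⌈k·n^{2/k}/(20e)⌉, ⌊k/4⌋)` is at most `n`. -/
theorem choose_segments_le (n k : ℕ) (hk : 5 ≤ k) (hn : 2 ^ k < n) :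
    Nat.choose (⌈(k : ℝ) * (n : ℝ) ^ ((2 : ℝ) / k) / (20 * Real.exp 1)⌉₊) (k / 4) ≤ n := by
  have hk0 : (0 : ℝ) < k := by exact_mod_cast (by omega : 0 < k)
  have hn1 : (1 : ℝ) ≤ n := by exact_mod_cast Nat.one_le_two_pow.trans hn.le
  have hm : 0 < k / 4 := by omega
  have hkm : (k : ℝ) ≤ 7 * (k / 4 : ℕ) := by exact_mod_cast (by omega : k ≤ 7 * (k / 4))
  have hmk : 4 * ((k / 4 : ℕ) : ℝ) ≤ k := by exact_mod_cast (by omega : 4 * (k / 4) ≤ k)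
  have hm1 : (1 : ℝ) ≤ (k / 4 : ℕ) := by exact_mod_cast hm
  generalize k / 4 = m at *
  set y : ℝ := (n : ℝ) ^ ((2 : ℝ) / k) with hy
  have hy4 : 4 ≤ y := by
    have h2 : ((2 : ℝ) ^ (k : ℝ)) ^ ((2 : ℝ) / k) = 4 := by
      rw [← Real.rpow_mul (by norm_num), mul_div_cancel₀ _ hk0.ne']
      norm_num
    rw [← h2, hy, Real.rpow_natCast]
    have h : (2 : ℝ) ^ k ≤ n := by exact_mod_cast hn.le
    gcongr
  have hpow : (y ^ 2) ^ m ≤ n := by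
    rw [← pow_mul, hy, ← Real.rpow_mul_natCast (by positivity)]
    refine (Real.rpow_le_rpow_of_exponent_le hn1 ?_).trans_eq (Real.rpow_one _)
    rw [div_mul_eq_mul_div, div_le_one hk0]
    push_cast
    linarith
  have hbase : Real.exp 1 * ⌈(k : ℝ) * y / (20 * Real.exp 1)⌉₊ / m ≤ y ^ 2 := by
    have hceil := (Nat.ceil_lt_add_one
      (show 0 ≤ (k : ℝ) * y / (20 * Real.exp 1) by positivity)).le
    rw [div_le_iff₀ (by linarith)]
    calc _ ≤ Real.exp 1 * ((k : ℝ) * y / (20 * Real.exp 1) + 1) := by gcongr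
      _ = k * y / 20 + Real.exp 1 := by field_simp
      _ ≤ 7 * m * y / 20 + 3 * m := by
        have := Real.exp_one_lt_three
        gcongr
        linarith
      _ = (7 / 20 * y + 3) * m := by ring
      _ ≤ y ^ 2 * m := by
        gcongr
        nlinarith
  have h := (choose_le_exp_mul_div_pow _ hm).trans
    ((pow_le_pow_left₀ (by positivity) hbase m).trans hpow)
  exact_mod_cast h
end

section
/- Let G be a finite simple graph in which every vertex has degree at least 2, let r be a positive integer, and suppose the girth of G is greater than 2r. Then for every vertex v and every integer j with 1 ≤ j ≤ r, the number of vertices at distance exactly j from v is at least the number of vertices at distance exactly j − 1 from v, i.e., |S_j(v)| ≥ |S_{j−1}(v)|. -/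
namespace SimpleGraph

variable {V : Type*} {G : SimpleGraph V}

/-- Two paths with the same endpoints whose total length is less than the girth coincide. -/
theorem Walk.IsPath.eq_of_length_add_length_lt_egirth {u w : V} {p q : G.Walk u w}
    (hp : p.IsPath) (hq : q.IsPath) (h : ((p.length + q.length : ℕ) : ℕ∞) < G.egirth) :
    p = q := by
  classical
  set H : SimpleGraph V := fromEdgeSet {e | e ∈ p.edges ++ q.edges} with hH
  have hmem : ∀ e ∈ p.edges ++ q.edges, e ∈ H.edgeSet := by
    intro e he
    have heG : e ∈ G.edgeSet := by
      rcases List.mem_append.1 he with he | he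
      · exact p.edges_subset_edgeSet he
      · exact q.edges_subset_edgeSet he
    rw [hH, edgeSet_fromEdgeSet]
    exact ⟨he, G.not_isDiag_of_mem_edgeSet heG⟩
  have hpH : ∀ e ∈ p.edges, e ∈ H.edgeSet := fun e he => hmem e (List.mem_append_left _ he)
  have hqH : ∀ e ∈ q.edges, e ∈ H.edgeSet := fun e he => hmem e (List.mem_append_right _ he)
  have hHp : ∀ e ∈ H.edgeSet, e ∈ p.edges ++ q.edges := by
    intro e he
    rw [hH, edgeSet_fromEdgeSet] at he
    exact he.1
  have hac : H.IsAcyclic := by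
    intro a c hc
    have hcG : ∀ e ∈ c.edges, e ∈ G.edgeSet := by
      intro e he
      rcases List.mem_append.1 (hHp e (c.edges_subset_edgeSet he)) with he | he
      · exact p.edges_subset_edgeSet he
      · exact q.edges_subset_edgeSet he
    have hle : c.edges.length ≤ (p.edges ++ q.edges).length :=
      (List.subperm_of_subset hc.edges_nodup
        fun e he => hHp e (c.edges_subset_edgeSet he)).length_le
    have hgirth := egirth_le_length (hc.transfer hcG)
    rw [length_transfer] at hgirth
    simp only [List.length_append, length_edges] at hle
    have := h.trans_le hgirth
    norm_cast at this
    omega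
  have heq := congrArg Subtype.val
    ((hac.subsingleton_path _ _).elim ⟨p.transfer H hpH, hp.transfer hpH⟩ ⟨q.transfer H hqH, hq.transfer hqH⟩)
  have hsupp := congrArg Walk.support heq
  simp only [support_transfer] at hsupp
  exact Walk.ext_support hsupp

/-- A shortest walk to a vertex `x` no farther from `v` than its neighbour `y` extends to a path
ending with the edge `xy`. -/
theorem exists_isPath_penultimate_eq {v x y : V} {a : ℕ} (hxy : G.Adj x y)
    (hx : G.edist v x = a) (hle : G.edist v x ≤ G.edist v y) :
    ∃ p : G.Walk v y, p.IsPath ∧ p.length = a + 1 ∧ p.penultimate = x := by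
  classical
  obtain ⟨p, hp⟩ := exists_walk_of_edist_eq_coe hx
  have hdist : p.length = G.dist v x := by rw [hp, dist, hx, ENat.toNat_natCast]
  refine ⟨p.concat hxy, (p.isPath_of_length_eq_dist hdist).concat ?_ hxy, ?_, ?_⟩
  · intro hy
    have h1 := p.length_takeUntil_lt_length hy hxy.ne'
    have h2 := hle.trans (edist_le (p.takeUntil y hy))
    rw [hx] at h2
    norm_cast at h2
    omega
  · simp [hp]
  · simp

/-- Within half the girth, a vertex has at most one neighbour that is no farther from `v`. -/
theorem eq_of_adj_of_edist_le {v x x' y : V} {a b r : ℕ} (hg : (2 * r : ℕ) < G.egirth)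
    (hxy : G.Adj x y) (hxy' : G.Adj x' y) (hx : G.edist v x = a) (hx' : G.edist v x' = b)
    (hle : G.edist v x ≤ G.edist v y) (hle' : G.edist v x' ≤ G.edist v y)
    (ha : a + 1 ≤ r) (hb : b + 1 ≤ r) : x = x' := by
  obtain ⟨p, hp, hpl, rfl⟩ := exists_isPath_penultimate_eq hxy hx hle
  obtain ⟨q, hq, hql, rfl⟩ := exists_isPath_penultimate_eq hxy' hx' hle'
  rw [hp.eq_of_length_add_length_lt_egirth hq (lt_of_le_of_lt (by norm_cast; omega) hg)]

/-- In a graph of minimum degree at least two, every vertex within half the girth of `v` has a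
neighbour one step farther from `v`. -/
theorem exists_adj_edist_eq_add_one [Fintype V] [DecidableRel G.Adj] {v x : V} {i r : ℕ}
    (hdeg : 2 ≤ G.degree x) (hg : (2 * r : ℕ) < G.egirth) (hx : G.edist v x = i)
    (hi : i + 1 ≤ r) : ∃ y, G.Adj x y ∧ G.edist v y = (i + 1 : ℕ) := by
  by_contra! hcon
  have hclose : ∀ y, G.Adj x y → ∃ a : ℕ, G.edist v y = a ∧ a ≤ i := by
    intro y hxy
    have htri : G.edist v y ≤ (i + 1 : ℕ) := by
      calc G.edist v y ≤ G.edist v x + G.edist x y := G.edist_triangle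
        _ = (i + 1 : ℕ) := by rw [hx, edist_eq_one_iff_adj.2 hxy]; norm_cast
    obtain ⟨a, ha⟩ := ENat.ne_top_iff_exists.1 (ne_top_of_le_ne_top (ENat.natCast_ne_top _) htri)
    have hne := hcon y hxy
    rw [← ha] at htri hne
    norm_cast at htri hne
    exact ⟨a, ha.symm, by omega⟩
  rw [← card_neighborFinset_eq_degree] at hdeg
  obtain ⟨y, hy, z, hz, hyz⟩ := Finset.one_lt_card.1 hdeg
  rw [mem_neighborFinset] at hy hz
  obtain ⟨a, ha, hai⟩ := hclose y hy
  obtain ⟨b, hb, hbi⟩ := hclose z hz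
  refine hyz (eq_of_adj_of_edist_le hg hy.symm hz.symm ha hb ?_ ?_ (by omega) (by omega))
  · rw [ha, hx]; exact_mod_cast hai
  · rw [hb, hx]; exact_mod_cast hbi

end SimpleGraph

/-- In a graph of minimum degree at least `2` and girth greater than `2r`, the spheres
around any vertex grow: for `1 ≤ j ≤ r`, `|S_j(v)| ≥ |S_{j-1}(v)|`. -/
theorem sphere_card_mono {V : Type*} [Fintype V] (G : SimpleGraph V)
    [DecidableRel G.Adj]
    (hdeg : ∀ v : V, 2 ≤ G.degree v)
    (r : ℕ) (hr : 0 < r) (hg : (2 * r : ℕ) < G.egirth)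
    (v : V) (j : ℕ) (hj1 : 1 ≤ j) (hjr : j ≤ r) :
    {u : V | G.edist v u = (j - 1 : ℕ)}.ncard ≤ {u : V | G.edist v u = (j : ℕ)}.ncard := by
  obtain ⟨i, rfl⟩ : ∃ i, j = i + 1 := ⟨j - 1, by omega⟩
  rw [Nat.add_sub_cancel]
  choose f hadj hf using fun (x : V) (hx : G.edist v x = (i : ℕ)) =>
    SimpleGraph.exists_adj_edist_eq_add_one (hdeg x) hg hx hjr
  refine Set.ncard_le_ncard_of_injOn (fun x => if hx : G.edist v x = (i : ℕ) then f x hx else x)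
    ?_ ?_ (Set.toFinite _)
  · intro x hx
    simp only [Set.mem_ofPred_eq] at hx ⊢
    rw [dif_pos hx]
    exact hf x hx
  · intro x hx y hy hxy
    simp only [Set.mem_ofPred_eq] at hx hy
    simp only [dif_pos hx, dif_pos hy] at hxy
    have hle : (i : ℕ∞) ≤ (i + 1 : ℕ) := by norm_cast; omega
    refine SimpleGraph.eq_of_adj_of_edist_le hg (hadj x hx) (hxy ▸ hadj y hy) hx hy ?_ ?_ hjr hjr
    · rw [hx, hf x hx]; exact hle
    · rw [hy, hf x hx]; exact hle
end

section
/- Let G be a finite simple graph on n vertices in which every vertex has degree at least 2. Then for every vertex v and every integer a ≥ 1 such that S_a(v) is nonempty, the girth of G is at most 2a + 2·⌊n / |S_a(v)|⌋. -/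
namespace SimpleGraph

/-- Two distinct paths with the same endpoints force a cycle no longer than their total length. -/
theorem Walk.IsPath.egirth_le_length_add_length {V : Type*} {G : SimpleGraph V} {u v : V}
    {p q : G.Walk u v} (hp : p.IsPath) (hq : q.IsPath) (hne : p ≠ q) :
    G.egirth ≤ ((p.length + q.length : ℕ) : ℕ∞) := by
  classical
  let H : SimpleGraph V := fromEdgeSet {e | e ∈ p.edges ++ q.edges}
  have mem_edgeSet_H {e : Sym2 V} (he : e ∈ p.edges ++ q.edges) : e ∈ H.edgeSet := by
    have heG : e ∈ G.edgeSet := by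
      rcases List.mem_append.mp he with h | h
      exacts [p.edges_subset_edgeSet h, q.edges_subset_edgeSet h]
    rw [edgeSet_fromEdgeSet]
    exact ⟨he, G.not_isDiag_of_mem_edgeSet heG⟩
  have hHG : H ≤ G := by
    intro x y hxy
    rcases List.mem_append.mp ((fromEdgeSet_adj _).mp hxy).1 with h | h
    exacts [p.adj_of_mem_edges h, q.adj_of_mem_edges h]
  have hpH : ∀ e ∈ p.edges, e ∈ H.edgeSet := fun e he ↦
    mem_edgeSet_H (List.mem_append_left _ he)
  have hqH : ∀ e ∈ q.edges, e ∈ H.edgeSet := fun e he ↦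
    mem_edgeSet_H (List.mem_append_right _ he)
  have hcyc : ¬ H.IsAcyclic := by
    intro hac
    have heq := congrArg (fun r : H.Path u v ↦ (r : H.Walk u v).support)
      ((hac.subsingleton_path u v).elim ⟨_, hp.transfer hpH⟩ ⟨_, hq.transfer hqH⟩)
    simp only [Walk.support_transfer] at heq
    exact hne (Walk.ext_support heq)
  obtain ⟨x, w, hw, hlen⟩ := exists_egirth_eq_length.mpr hcyc
  refine (egirth_anti hHG).trans (hlen.trans_le (Nat.cast_le.mpr ?_))
  have hsub : w.edges ⊆ p.edges ++ q.edges := fun e he ↦ by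
    have h := w.edges_subset_edgeSet he
    rw [edgeSet_fromEdgeSet] at h
    exact h.1
  simpa using (List.subperm_of_subset hw.edges_nodup hsub).length_le

/-- If `u` is at least as far from `v` as its neighbor `x`, a shortest path from `v` to `x`
extends to a path ending at `u`. -/
theorem exists_isPath_concat_of_edist_le {V : Type*} {G : SimpleGraph V} {u v x : V} {m : ℕ}
    (hx : G.edist v x = m) (hxu : G.edist v x ≤ G.edist v u) (hadj : G.Adj x u) :
    ∃ p : G.Walk v x, p.length = m ∧ (p.concat hadj).IsPath := by
  classical
  obtain ⟨p, hp⟩ := exists_walk_of_edist_eq_coe hx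
  have hdist : G.dist v x = m := by simp [dist, hx]
  refine ⟨p, hp, (p.isPath_of_length_eq_dist (hp.trans hdist.symm)).concat ?_ hadj⟩
  intro hu
  have hlt := p.length_takeUntil_lt_length hu hadj.ne'
  have hle := hxu.trans (edist_le (p.takeUntil u hu))
  rw [hx, Nat.cast_le] at hle
  omega

/-- If `u` has two neighbors at distances `m` and `l` from `v`, neither farther from `v` than `u`,
then the girth is at most `m + l + 2`. -/
theorem egirth_le_of_two_adj_edist_le {V : Type*} {G : SimpleGraph V} {u v x y : V} {m l : ℕ}
    (hne : x ≠ y) (hux : G.Adj u x) (huy : G.Adj u y)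
    (hx : G.edist v x = m) (hy : G.edist v y = l)
    (hxu : G.edist v x ≤ G.edist v u) (hyu : G.edist v y ≤ G.edist v u) :
    G.egirth ≤ ((m + l + 2 : ℕ) : ℕ∞) := by
  obtain ⟨p, hpl, hp⟩ := exists_isPath_concat_of_edist_le hx hxu hux.symm
  obtain ⟨q, hql, hq⟩ := exists_isPath_concat_of_edist_le hy hyu huy.symm
  have hpq : p.concat hux.symm ≠ q.concat huy.symm := fun h ↦ hne <| by
    simpa using congrArg Walk.penultimate h
  refine (hp.egirth_le_length_add_length hq hpq).trans (Nat.cast_le.mpr ?_)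
  simp only [Walk.length_concat]
  omega

/-- Spheres do not shrink while their radius stays below half the girth. -/
theorem ncard_sphere_le_ncard_sphere_succ {V : Type*} [Fintype V] {G : SimpleGraph V}
    [DecidableRel G.Adj] (hdeg : ∀ v : V, 2 ≤ G.degree v) (v : V) (i : ℕ)
    (hg : ((2 * i + 2 : ℕ) : ℕ∞) < G.egirth) :
    {u : V | G.edist v u = (i : ℕ)}.ncard ≤ {u : V | G.edist v u = (i + 1 : ℕ)}.ncard := by
  have hchild : ∀ u : V, G.edist v u = (i : ℕ) →
      ∃ w, G.Adj u w ∧ G.edist v w = (i + 1 : ℕ) := by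
    intro u hu
    by_contra! hno
    have hle : ∀ w, G.Adj u w → ∃ m : ℕ, G.edist v w = m ∧ m ≤ i := by
      intro w hw
      have h1 : G.edist v w ≤ ((i + 1 : ℕ) : ℕ∞) := by
        have := G.edist_triangle (u := v) (v := u) (w := w)
        rwa [hu, edist_eq_one_iff_adj.mpr hw] at this
      obtain ⟨m, hm⟩ := ENat.ne_top_iff_exists.mp (h1.trans_lt (ENat.natCast_lt_top _)).ne
      have h2 := hno w hw
      rw [← hm] at h1 h2
      have h1' : m ≤ i + 1 := by exact_mod_cast h1
      have h2' : m ≠ i + 1 := by exact_mod_cast h2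
      exact ⟨m, hm.symm, by omega⟩
    obtain ⟨x, hx, y, hy, hxy⟩ := Finset.one_lt_card.mp (hdeg u)
    rw [mem_neighborFinset] at hx hy
    obtain ⟨m, hm, hmi⟩ := hle x hx
    obtain ⟨l, hl, hli⟩ := hle y hy
    refine hg.not_ge ((egirth_le_of_two_adj_edist_le hxy hx hy hm hl ?_ ?_).trans ?_)
    · rw [hm, hu]; exact_mod_cast hmi
    · rw [hl, hu]; exact_mod_cast hli
    · exact_mod_cast (by omega : m + l + 2 ≤ 2 * i + 2)
  choose! f hadj hf using hchild
  refine Set.ncard_le_ncard_of_injOn f (fun u hu ↦ hf u hu) ?_ (Set.toFinite _)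
  intro x hx y hy hxy
  by_contra hne
  have hle : ((i : ℕ) : ℕ∞) ≤ ((i + 1 : ℕ) : ℕ∞) := by exact_mod_cast i.le_succ
  refine hg.not_ge ((egirth_le_of_two_adj_edist_le hne (hadj x hx).symm
    (hxy ▸ (hadj y hy).symm) hx hy ?_ ?_).trans ?_)
  · rw [hf x hx, show G.edist v x = i from hx]; exact hle
  · rw [hf x hx, show G.edist v y = i from hy]; exact hle
  · exact_mod_cast (by omega : i + i + 2 ≤ 2 * i + 2)

end SimpleGraph

/-- In a graph on `n` vertices of minimum degree at least `2`, for any vertex `v` and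
any `a ≥ 1` with `S_a(v) ≠ ∅`, the girth is at most `2a + 2⌊n / |S_a(v)|⌋`. -/
theorem girth_le_of_sphere {V : Type*} [Fintype V] (G : SimpleGraph V)
    [DecidableRel G.Adj]
    (hdeg : ∀ v : V, 2 ≤ G.degree v)
    (v : V) (a : ℕ) (ha : 1 ≤ a)
    (hS : {u : V | G.edist v u = (a : ℕ)}.Nonempty) :
    G.egirth ≤
      ((2 * a + 2 * (Fintype.card V / {u : V | G.edist v u = (a : ℕ)}.ncard) : ℕ) : ℕ∞) := by
  classical
  set s := {u : V | G.edist v u = (a : ℕ)}.ncard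
  set k := Fintype.card V / s
  have hspos : 0 < s := (Set.ncard_pos).mpr hS
  by_contra! hg
  have hgrow : ∀ i ≤ k, s ≤ {u : V | G.edist v u = (a + i : ℕ)}.ncard := by
    intro i
    induction i with
    | zero => exact fun _ ↦ le_rfl
    | succ i ih =>
      intro hi
      refine (ih (by omega)).trans
        (SimpleGraph.ncard_sphere_le_ncard_sphere_succ hdeg v (a + i) (lt_of_le_of_lt ?_ hg))
      exact_mod_cast (by omega : 2 * (a + i) + 2 ≤ 2 * a + 2 * k)
  have hdisj : ((Finset.range (k + 1) : Finset ℕ) : Set ℕ).PairwiseDisjoint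
      fun i ↦ Finset.univ.filter fun u : V ↦ G.edist v u = (a + i : ℕ) := by
    intro i _ j _ hij
    refine Finset.disjoint_left.mpr fun u hu hu' ↦ hij ?_
    simp only [Finset.mem_filter, Finset.mem_univ, true_and] at hu hu'
    have h : a + i = a + j := by exact_mod_cast hu.symm.trans hu'
    omega
  have hcard : (k + 1) * s ≤ Fintype.card V := by
    calc (k + 1) * s = ∑ _i ∈ Finset.range (k + 1), s := by simp
      _ ≤ ∑ i ∈ Finset.range (k + 1),
          (Finset.univ.filter fun u : V ↦ G.edist v u = (a + i : ℕ)).card := by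
        refine Finset.sum_le_sum fun i hi ↦ (hgrow i (by simpa [Nat.lt_succ_iff] using hi)).trans ?_
        rw [← Set.ncard_coe_finset]
        simp
      _ = _ := (Finset.card_biUnion hdisj).symm
      _ ≤ Fintype.card V := Finset.card_le_univ _
  have hlt : Fintype.card V < s * (k + 1) := Nat.lt_mul_div_succ _ hspos
  rw [mul_comm] at hlt
  omega
end

section
/- Let G be a finite simple graph with n vertices and m edges, let x ≥ 8 be an integer, and set m̃ = max(m, n·x). Let R be a partition of the vertex set of G into at most x/4 parts, each part Q of R satisfying Σ_{v ∈ Q} deg(v) ≤ 8m/x + n, and let Q_0, …, Q_{ℓ−1} be ℓ ≥ 1 distinct parts of R. Then there exists a partition M of the vertex set of G that refines R, has at most x parts, and is such that every part N of M satisfies both Σ_{v ∈ N} deg(v) ≤ 8m/x + n and Σ_{i<ℓ} e(N, Q_i) ≤ 32·ℓ·m̃/x² + n, where e(N, Q_i) denotes the number of edges of G with one endpoint in N and the other endpoint in Q_i. -/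
/-- The number of edges of `G` with one endpoint in `A` and the other endpoint in `B`. -/
noncomputable def edgesBetween {V : Type*} (G : SimpleGraph V) (A B : Finset V) : ℕ :=
  {e : Sym2 V | e ∈ G.edgeSet ∧ ∃ a ∈ A, ∃ b ∈ B, e = s(a, b)}.ncard

/-- A finite set of total weight at least `T > 0` contains a subset of weight between `T` and
`T + c`, where `c` bounds every single weight. -/
theorem Finset.exists_subset_sum_mem_Icc {V : Type*} [DecidableEq V] (w : V → ℝ) (c T : ℝ)
    (hw : ∀ v, w v ≤ c) (hT : 0 < T) (s : Finset V) (hs : T ≤ ∑ v ∈ s, w v) :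
    ∃ t ⊆ s, T ≤ ∑ v ∈ t, w v ∧ ∑ v ∈ t, w v ≤ T + c := by
  induction s using Finset.induction_on with
  | empty => simp at hs; linarith
  | insert a s ha ih =>
    by_cases h : T ≤ ∑ v ∈ s, w v
    · obtain ⟨t, ht, h'⟩ := ih h
      exact ⟨t, ht.trans (Finset.subset_insert a s), h'⟩
    · refine ⟨insert a s, subset_rfl, hs, ?_⟩
      rw [Finset.sum_insert ha]
      linarith [hw a]

/-- A finite set with nonnegative weights at most `c` can be partitioned into parts of weight at
most `T + c`, all but one of which account for weight at least `T` each. -/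
theorem Finset.exists_finpartition_sum_le {V : Type*} [DecidableEq V] (w : V → ℝ) (c T : ℝ)
    (hw₀ : ∀ v, 0 ≤ w v) (hw : ∀ v, w v ≤ c) (hT : 0 < T) (s : Finset V) :
    ∃ P : Finpartition s, (∀ N ∈ P.parts, ∑ v ∈ N, w v ≤ T + c) ∧
      ((P.parts.card : ℝ) - 1) * T ≤ ∑ v ∈ s, w v := by
  induction s using Finset.strongInduction with
  | H s ih =>
    have hs₀ : 0 ≤ ∑ v ∈ s, w v := Finset.sum_nonneg fun v _ => hw₀ v
    rcases s.eq_empty_or_nonempty with rfl | hne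
    · refine ⟨Finpartition.empty _, by simp, ?_⟩
      simp
      linarith
    by_cases h : T ≤ ∑ v ∈ s, w v
    · obtain ⟨t, hts, ht, ht'⟩ := Finset.exists_subset_sum_mem_Icc w c T hw hT s h
      have htne : t.Nonempty := by
        rw [Finset.nonempty_iff_ne_empty]
        rintro rfl
        simp at ht
        linarith
      obtain ⟨P, hP, hPcard⟩ := ih (s \ t) (Finset.sdiff_ssubset hts htne)
      refine ⟨P.extend htne.ne_empty Finset.sdiff_disjoint
        (Finset.sdiff_union_of_subset hts), ?_, ?_⟩
      · intro N hN
        replace hN : N ∈ insert t P.parts := hN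
        rw [Finset.mem_insert] at hN
        rcases hN with rfl | hN
        · exact ht'
        · exact hP N hN
      · rw [Finpartition.card_extend]
        push_cast
        have := Finset.sum_sdiff (f := w) hts
        linarith
    · refine ⟨Finpartition.indiscrete hne.ne_empty, ?_, ?_⟩
      · intro N hN
        obtain rfl : N = s := by simpa using hN
        obtain ⟨v, -⟩ := hne
        linarith [hw₀ v, hw v]
      · simpa using hs₀

theorem edgesBetween_le_sum {V : Type*} [DecidableEq V] (G : SimpleGraph V)
    [DecidableRel G.Adj] (A B : Finset V) :
    edgesBetween G A B ≤ ∑ a ∈ A, (B.filter (G.Adj a)).card := by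
  have hsub : {e : Sym2 V | e ∈ G.edgeSet ∧ ∃ a ∈ A, ∃ b ∈ B, e = s(a, b)} ⊆
      ↑(A.biUnion fun a => (B.filter (G.Adj a)).image fun b => s(a, b)) := by
    rintro e ⟨he, a, ha, b, hb, rfl⟩
    rw [SimpleGraph.mem_edgeSet] at he
    simp only [Finset.coe_biUnion, Set.mem_iUnion, Finset.mem_coe, Finset.mem_image,
      Finset.mem_filter]
    exact ⟨a, ha, b, ⟨hb, he⟩, rfl⟩
  calc edgesBetween G A B
      ≤ (A.biUnion fun a => (B.filter (G.Adj a)).image fun b => s(a, b)).card := by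
        rw [← Set.ncard_coe_finset]
        exact Set.ncard_le_ncard hsub (Finset.finite_toSet _)
    _ ≤ ∑ a ∈ A, ((B.filter (G.Adj a)).image fun b => s(a, b)).card := Finset.card_biUnion_le
    _ ≤ _ := Finset.sum_le_sum fun a _ => Finset.card_image_le

theorem SimpleGraph.sum_card_filter_adj {V : Type*} [Fintype V] (G : SimpleGraph V)
    [DecidableRel G.Adj] (B : Finset V) :
    ∑ v, (B.filter (G.Adj v)).card = ∑ u ∈ B, G.degree u := by
  have h := Finset.sum_card_bipartiteAbove_eq_sum_card_bipartiteBelow (s := Finset.univ)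
    (t := B) G.Adj
  simp only [Finset.bipartiteAbove, Finset.bipartiteBelow] at h
  rw [h]
  refine Finset.sum_congr rfl fun u _ => ?_
  rw [← G.card_neighborFinset_eq_degree, G.neighborFinset_eq_filter]
  simp only [G.adj_comm]

/-- **Refined partition.** Given a partition `R` of the vertices into at most `x/4` parts
with each part `Q` satisfying `Σ_{v∈Q} deg(v) ≤ 8m/x + n`, and `ℓ ≥ 1` distinct parts
`Q_0, …, Q_{ℓ-1}` of `R`, there is a partition `M` refining `R`, with at most `x` parts,
such that every part `N` of `M` satisfies `Σ_{v∈N} deg(v) ≤ 8m/x + n` and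
`Σ_{i<ℓ} e(N, Q_i) ≤ 32·ℓ·m̃/x² + n`, where `m̃ = max(m, n·x)`. -/
theorem exists_refined_partition {V : Type*} [Fintype V] [DecidableEq V]
    (G : SimpleGraph V) [DecidableRel G.Adj] (x : ℕ) (hx : 8 ≤ x)
    (R : Finpartition (Finset.univ : Finset V))
    (hRcard : (R.parts.card : ℝ) ≤ (x : ℝ) / 4)
    (hRdeg : ∀ Q ∈ R.parts,
      ((∑ v ∈ Q, G.degree v : ℕ) : ℝ) ≤
        8 * (G.edgeFinset.card : ℝ) / x + Fintype.card V)
    (ℓ : ℕ) (hℓ : 1 ≤ ℓ) (Q : Fin ℓ → Finset V)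
    (hQmem : ∀ i, Q i ∈ R.parts) (hQinj : Function.Injective Q) :
    ∃ M : Finpartition (Finset.univ : Finset V),
      (∀ N ∈ M.parts, ∃ Q' ∈ R.parts, N ⊆ Q') ∧
      M.parts.card ≤ x ∧
      ∀ N ∈ M.parts,
        ((∑ v ∈ N, G.degree v : ℕ) : ℝ) ≤
            8 * (G.edgeFinset.card : ℝ) / x + Fintype.card V ∧
        ((∑ i, edgesBetween G N (Q i) : ℕ) : ℝ) ≤
            32 * ℓ * (max (G.edgeFinset.card : ℝ) (Fintype.card V * x)) / x ^ 2
              + Fintype.card V := by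
  rcases isEmpty_or_nonempty V with hV | hV
  · refine ⟨R, fun N hN => ⟨N, hN, subset_rfl⟩, ?_, fun N hN => ?_⟩
    · have : (R.parts.card : ℝ) ≤ x := by
        have : (0 : ℝ) ≤ x := x.cast_nonneg
        linarith
      exact_mod_cast this
    · exact absurd (Finset.eq_empty_of_isEmpty N) (R.nonempty_of_mem_parts hN).ne_empty
  set n : ℝ := (Fintype.card V : ℝ) with hn
  set m : ℝ := (G.edgeFinset.card : ℝ) with hm
  have hx0 : (0 : ℝ) < x := by exact_mod_cast (by omega : 0 < x)
  have hn0 : 0 < n := by simpa [hn] using Fintype.card_pos (α := V)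
  have hℓ0 : (0 : ℝ) < ℓ := by exact_mod_cast hℓ
  set μ : ℝ := max m (n * x) with hμ
  have hμ0 : 0 < μ := lt_max_of_lt_right (mul_pos hn0 hx0)
  set T : ℝ := 32 * ℓ * μ / x ^ 2 with hT
  have hT0 : 0 < T := by positivity
  let wt : V → ℕ := fun v => ∑ i, ((Q i).filter (G.Adj v)).card
  have hwt (v : V) : (wt v : ℝ) ≤ n := by
    have hdisj : (Set.univ : Set (Fin ℓ)).PairwiseDisjoint
        fun i => (Q i).filter (G.Adj v) := fun i _ j _ hij =>
      Finset.disjoint_filter_filter (R.disjoint (hQmem i) (hQmem j) (hQinj.ne hij))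
    have : wt v ≤ Fintype.card V := by
      simp only [wt]
      rw [← Finset.card_biUnion fun i _ j _ hij => hdisj trivial trivial hij]
      exact Finset.card_le_univ _
    rw [hn]
    exact_mod_cast this
  have hbound : 8 * m / x + n ≤ 9 * μ / x := by
    rw [div_add' _ _ _ hx0.ne']
    gcongr
    linarith [le_max_left m (n * x), le_max_right m (n * x)]
  have htotal : (∑ v, (wt v : ℝ)) ≤ ℓ * (9 * μ / x) := by
    have h : ∑ v, wt v = ∑ i, ∑ u ∈ Q i, G.degree u := by
      simp only [wt]
      rw [Finset.sum_comm]
      exact Finset.sum_congr rfl fun i _ => G.sum_card_filter_adj (Q i)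
    calc (∑ v, (wt v : ℝ)) = ∑ i, ((∑ u ∈ Q i, G.degree u : ℕ) : ℝ) := by exact_mod_cast h
      _ ≤ ∑ _i : Fin ℓ, 9 * μ / x :=
        Finset.sum_le_sum fun i _ => (hRdeg _ (hQmem i)).trans hbound
      _ = ℓ * (9 * μ / x) := by simp
  choose P hP hPcard using Finset.exists_finpartition_sum_le (fun v => (wt v : ℝ)) n T
    (fun v => Nat.cast_nonneg _) hwt hT0
  refine ⟨R.bind fun S _ => P S, ?_, ?_, ?_⟩
  · intro N hN
    obtain ⟨S, hS, hNS⟩ := Finpartition.mem_bind.1 hN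
    exact ⟨S, hS, (P S).le hNS⟩
  · have hsum : ∑ S ∈ R.parts, ∑ v ∈ S, (wt v : ℝ) = ∑ v, (wt v : ℝ) := by
      conv_rhs => rw [← R.biUnion_parts]
      exact (Finset.sum_biUnion R.disjoint).symm
    have hcard : (((R.bind fun S _ => P S).parts.card : ℝ) - R.parts.card) * T ≤
        ℓ * (9 * μ / x) := by
      refine le_trans ?_ (hsum.le.trans htotal)
      rw [Finpartition.card_bind, Finset.sum_attach _ fun S => (P S).parts.card]
      refine le_trans (le_of_eq ?_) (Finset.sum_le_sum fun S _ => hPcard S)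
      rw [← Finset.sum_mul, Finset.sum_sub_distrib]
      simp
    have hTeq : ℓ * (9 * μ / x) = 9 * x / 32 * T := by
      rw [hT]
      field_simp
    rw [hTeq] at hcard
    have := le_of_mul_le_mul_right hcard hT0
    have : ((R.bind fun S _ => P S).parts.card : ℝ) ≤ x := by linarith
    exact_mod_cast this
  · intro N hN
    obtain ⟨S, hS, hNS⟩ := Finpartition.mem_bind.1 hN
    constructor
    · refine le_trans ?_ (hRdeg S hS)
      exact_mod_cast Finset.sum_le_sum_of_subset ((P S).le hNS)
    · refine le_trans ?_ (hP S N hNS)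
      have : ∑ i, edgesBetween G N (Q i) ≤ ∑ v ∈ N, wt v := by
        simp only [wt]
        rw [Finset.sum_comm]
        exact Finset.sum_le_sum fun i _ => edgesBetween_le_sum G N (Q i)
      exact_mod_cast this
end

section
/- Let G be a finite simple graph with vertex set V and let c : V → ℤ/6ℤ be a coloring. Define a directed relation E′ on V by: E′(u, v) holds if and only if there exists a vertex w with u adjacent to w, w adjacent to v, c(v) = c(u) + 2, and c(v) = c(w) + 1 (arithmetic in ℤ/6ℤ). Then there exist vertices v₁, v₂, v₃ with E′(v₁, v₂), E′(v₂, v₃), E′(v₃, v₁) (a directed triangle) if and only if G contains a 6-cycle u₀, u₁, …, u₅ with c(u_i) = i for every i ∈ {0, …, 5} (a correctly colored copy of C₆). -/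
/-- A closed walk of length six whose colors increase by one at each step can be rotated
to a correctly colored `C₆`. -/
theorem exists_colored_C6_of_closed_walk {V : Type*} (G : SimpleGraph V) (c : V → ZMod 6)
    (a : Fin 6 → V) (k : Fin 6) (ha : ∀ i, G.Adj (a i) (a (i + 1)))
    (hc : ∀ i : Fin 6, c (a i) = (k.val : ZMod 6) + (i.val : ZMod 6)) :
    ∃ u : Fin 6 → V, Function.Injective u ∧
      (∀ i : Fin 6, G.Adj (u i) (u (i + 1))) ∧
      (∀ i : Fin 6, c (u i) = (i.val : ZMod 6)) := by
  have cast_add_sub : ∀ k i : Fin 6,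
      (k.val : ZMod 6) + ((i - k).val : ZMod 6) = (i.val : ZMod 6) := by decide
  have color : ∀ i : Fin 6, c (a (i - k)) = (i.val : ZMod 6) := by
    intro i
    rw [hc, cast_add_sub]
  have cast_inj : ∀ i j : Fin 6, (i.val : ZMod 6) = (j.val : ZMod 6) → i = j := by decide
  refine ⟨fun i => a (i - k), fun i j hij => ?_, fun i => ?_, color⟩
  · apply cast_inj
    rw [← color i, ← color j]
    exact congrArg c hij
  · have h := ha (i - k)
    rwa [sub_add_eq_add_sub] at h

/-- **Reduction from `C₆` to directed triangles.** With `E′(u,v) ↔ ∃ w`, `u ~ w`, `w ~ v`,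
`c(v) = c(u) + 2` and `c(v) = c(w) + 1` (mod 6), the relation `E′` contains a directed
triangle iff `G` contains a correctly colored copy of `C₆`. -/
theorem directed_triangle_iff_colored_C6 {V : Type*} [Fintype V]
    (G : SimpleGraph V) (c : V → ZMod 6)
    (E' : V → V → Prop)
    (hE' : ∀ u v, E' u v ↔
      ∃ w, G.Adj u w ∧ G.Adj w v ∧ c v = c u + 2 ∧ c v = c w + 1) :
    (∃ v₁ v₂ v₃ : V, E' v₁ v₂ ∧ E' v₂ v₃ ∧ E' v₃ v₁) ↔
    (∃ u : Fin 6 → V, Function.Injective u ∧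
      (∀ i : Fin 6, G.Adj (u i) (u (i + 1))) ∧
      (∀ i : Fin 6, c (u i) = (i.val : ZMod 6))) := by
  constructor
  · rintro ⟨v₁, v₂, v₃, h₁₂, h₂₃, h₃₁⟩
    obtain ⟨w₁, a₁, b₁, p₁, q₁⟩ := (hE' _ _).1 h₁₂
    obtain ⟨w₂, a₂, b₂, p₂, q₂⟩ := (hE' _ _).1 h₂₃
    obtain ⟨w₃, a₃, b₃, p₃, q₃⟩ := (hE' _ _).1 h₃₁
    obtain ⟨k, hk⟩ : ∃ k : Fin 6, (k.val : ZMod 6) = c v₁ :=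
      ⟨⟨(c v₁).val, (c v₁).val_lt⟩, ZMod.natCast_zmod_val (c v₁)⟩
    refine exists_colored_C6_of_closed_walk G c ![v₁, w₁, v₂, w₂, v₃, w₃] k ?_ ?_
    · intro i
      fin_cases i
      exacts [a₁, b₁, a₂, b₂, a₃, b₃]
    · have e₁ : c w₁ = c v₁ + 1 := by linear_combination p₁ - q₁
      have e₂ : c w₂ = c v₁ + 3 := by linear_combination p₁ + p₂ - q₂
      have e₃ : c v₃ = c v₁ + 4 := by linear_combination p₁ + p₂
      have e₄ : c w₃ = c v₁ + 5 := by linear_combination p₁ + p₂ + p₃ - q₃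
      intro i
      rw [hk]
      fin_cases i
      · simp
      · simpa using e₁
      · simpa using p₁
      · simpa using e₂
      · simpa using e₃
      · simpa using e₄
  · rintro ⟨u, -, hadj, hcol⟩
    have edge : ∀ i : Fin 6, E' (u i) (u (i + 1 + 1)) := by
      intro i
      refine (hE' _ _).2 ⟨u (i + 1), hadj i, hadj (i + 1), ?_, ?_⟩
      all_goals
        rw [hcol, hcol]
        revert i
        decide
    exact ⟨u 0, u 2, u 4, edge 0, edge 2, edge 4⟩
end

section
/- Let G be a finite simple graph, and let u₀ and u₁ be adjacent vertices. Suppose v ≠ v′ are two vertices, both adjacent to u₀, both different from u₁, such that |N(v) ∩ N(u₁)| ≥ 4 and |N(v′) ∩ N(u₁)| ≥ 4. Then G contains a 6-cycle containing both v and v′. (Consequently, for a 6-cycle u₀, …, u₅ of G, at most one neighbor v of u₀ that does not lie on any 6-cycle can have more than 3 common neighbors with u₁.) -/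
/-- If `u₀ ~ u₁` and `v ≠ v′` are neighbors of `u₀`, both different from `u₁`, each
having at least `4` common neighbors with `u₁`, then `G` contains a 6-cycle through
both `v` and `v′`. -/
theorem six_cycle_of_common_neighbors {V : Type*} [Fintype V] [DecidableEq V]
    (G : SimpleGraph V) [DecidableRel G.Adj]
    (u₀ u₁ v v' : V)
    (hadj : G.Adj u₀ u₁)
    (hvv' : v ≠ v')
    (hv : G.Adj u₀ v) (hv' : G.Adj u₀ v')
    (hvne : v ≠ u₁) (hv'ne : v' ≠ u₁)
    (hcv : 4 ≤ (G.neighborFinset v ∩ G.neighborFinset u₁).card)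
    (hcv' : 4 ≤ (G.neighborFinset v' ∩ G.neighborFinset u₁).card) :
    ∃ x : Fin 6 → V, Function.Injective x ∧
      (∀ i : Fin 6, G.Adj (x i) (x (i + 1))) ∧
      (∃ i, x i = v) ∧ (∃ j, x j = v') := by
  obtain ⟨a, ha, ha'⟩ := Finset.exists_mem_notMem_of_card_lt_card
    (s := {u₀, v'}) (Finset.card_le_two.trans_lt (lt_of_lt_of_le (by decide) hcv))
  obtain ⟨b, hb, hb'⟩ := Finset.exists_mem_notMem_of_card_lt_card
    (s := {u₀, v, a}) (Finset.card_le_three.trans_lt (lt_of_lt_of_le (by decide) hcv'))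
  simp only [Finset.mem_inter, SimpleGraph.mem_neighborFinset, Finset.mem_insert,
    Finset.mem_singleton, not_or] at ha ha' hb hb'
  obtain ⟨hva, hua⟩ := ha
  obtain ⟨hvb, hub⟩ := hb
  refine ⟨![u₀, v, a, u₁, b, v'], ?_, ?_, ⟨1, rfl⟩, ⟨5, rfl⟩⟩
  · rw [← List.nodup_ofFn]
    have := hadj.ne
    have := hv.ne
    have := hv'.ne
    have := hva.ne
    have := hua.ne
    have := hvb.ne
    have := hub.ne
    simp [List.ofFn_succ]
    grind
  · intro i
    fin_cases i
    exacts [hv, hva, hua.symm, hub, hvb.symm, hv'.symm]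
end

section
/- Let G be a finite simple graph with vertex set V, let c : V → {0, 1, …, 7} be a coloring, and let u₀, u₁, u₂ be pairwise distinct vertices with c(u_i) = i for i = 0, 1, 2. A 0-1 path from a vertex x to u₂ is a pair of vertices (w₀, w₁) with c(w₀) = 0, c(w₁) = 1, w₀ ≠ u₀, w₁ ≠ u₁, such that x is adjacent to w₀, w₀ is adjacent to w₁, and w₁ is adjacent to u₂; two 0-1 paths (w₀, w₁) and (w₀′, w₁′) are node-disjoint if w₀ ≠ w₀′ and w₁ ≠ w₁′. Suppose v ≠ v′ are two vertices adjacent to u₀ with v, v′ ∉ {u₀, u₁, u₂}, each having at least 5 pairwise node-disjoint 0-1 paths to u₂. Then G contains an 8-cycle containing both v and v′. -/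
/-- Four properties, each holding for at most one of five indices, all fail at some index. -/
theorem exists_forall_not_of_at_most_one (P : Fin 4 → Fin 5 → Prop)
    (hP : ∀ k i j, P k i → P k j → i = j) : ∃ i, ∀ k, ¬ P k i := by
  by_contra! h
  choose k hk using h
  have hinj : Function.Injective k := fun i j hij => hP (k i) i j (hk i) (hij ▸ hk j)
  simpa using Fintype.card_le_of_injective k hinj

/-- Among five disjoint pairs whose first and second coordinates have different colors, some pair
has first coordinate different from `a`, second coordinate different from `b`, and avoids
both `x` and `y`. -/
theorem exists_pair_avoiding {V C : Type*} (c : V → C) {p q : C} (hpq : p ≠ q)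
    (f : Fin 5 → V × V) (hc : ∀ i, c (f i).1 = p ∧ c (f i).2 = q)
    (hf : ∀ i j, i ≠ j → (f i).1 ≠ (f j).1 ∧ (f i).2 ≠ (f j).2) (a b x y : V) :
    ∃ i, (f i).1 ≠ a ∧ (f i).2 ≠ b ∧ ((f i).1 ≠ x ∧ (f i).2 ≠ x) ∧
      ((f i).1 ≠ y ∧ (f i).2 ≠ y) := by
  have hfst : ∀ i j, (f i).1 = (f j).1 → i = j := fun i j h =>
    by_contra fun hij => (hf i j hij).1 h
  have hsnd : ∀ i j, (f i).2 = (f j).2 → i = j := fun i j h =>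
    by_contra fun hij => (hf i j hij).2 h
  have hcross : ∀ i j, (f i).1 ≠ (f j).2 := fun i j h =>
    hpq ((hc i).1.symm.trans ((congrArg c h).trans (hc j).2))
  have hmem : ∀ z i j, ((f i).1 = z ∨ (f i).2 = z) → ((f j).1 = z ∨ (f j).2 = z) → i = j := by
    rintro z i j (hi | hi) (hj | hj)
    · exact hfst i j (hi.trans hj.symm)
    · exact absurd (hi.trans hj.symm) (hcross i j)
    · exact absurd (hj.trans hi.symm) (hcross j i)
    · exact hsnd i j (hi.trans hj.symm)
  obtain ⟨i, hi⟩ := exists_forall_not_of_at_most_one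
    ![fun i => (f i).1 = a, fun i => (f i).2 = b, fun i => (f i).1 = x ∨ (f i).2 = x,
      fun i => (f i).1 = y ∨ (f i).2 = y] (by
    intro k i j
    fin_cases k
    · exact fun hi hj => hfst i j (hi.trans hj.symm)
    · exact fun hi hj => hsnd i j (hi.trans hj.symm)
    · exact hmem x i j
    · exact hmem y i j)
  exact ⟨i, hi 0, hi 1, not_or.mp (hi 2), not_or.mp (hi 3)⟩


/-- If two distinct neighbors `v ≠ v′` of `u₀` (avoiding `u₀, u₁, u₂`) each have at
least `5` pairwise node-disjoint 0-1 paths to `u₂`, then `G` contains an 8-cycle through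
both `v` and `v′`. -/
theorem eight_cycle_of_disjoint_zero_one_paths {V : Type*} [Fintype V]
    (G : SimpleGraph V) (c : V → Fin 8) (u₀ u₁ u₂ : V)
    (hdist : u₀ ≠ u₁ ∧ u₀ ≠ u₂ ∧ u₁ ≠ u₂)
    (hc0 : c u₀ = 0) (hc1 : c u₁ = 1) (hc2 : c u₂ = 2)
    (v v' : V) (hvv' : v ≠ v')
    (hv : G.Adj u₀ v) (hv' : G.Adj u₀ v')
    (hvne : v ∉ ({u₀, u₁, u₂} : Set V)) (hv'ne : v' ∉ ({u₀, u₁, u₂} : Set V))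
    (hpaths : ∃ f : Fin 5 → V × V,
      (∀ i, c (f i).1 = 0 ∧ c (f i).2 = 1 ∧ (f i).1 ≠ u₀ ∧ (f i).2 ≠ u₁ ∧
        G.Adj v (f i).1 ∧ G.Adj (f i).1 (f i).2 ∧ G.Adj (f i).2 u₂) ∧
      (∀ i j, i ≠ j → (f i).1 ≠ (f j).1 ∧ (f i).2 ≠ (f j).2))
    (hpaths' : ∃ f : Fin 5 → V × V,
      (∀ i, c (f i).1 = 0 ∧ c (f i).2 = 1 ∧ (f i).1 ≠ u₀ ∧ (f i).2 ≠ u₁ ∧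
        G.Adj v' (f i).1 ∧ G.Adj (f i).1 (f i).2 ∧ G.Adj (f i).2 u₂) ∧
      (∀ i j, i ≠ j → (f i).1 ≠ (f j).1 ∧ (f i).2 ≠ (f j).2)) :
    ∃ x : Fin 8 → V, Function.Injective x ∧
      (∀ i : Fin 8, G.Adj (x i) (x (i + 1))) ∧
      (∃ i, x i = v) ∧ (∃ j, x j = v') := by
  obtain ⟨f, hf, hfd⟩ := hpaths
  obtain ⟨g, hg, hgd⟩ := hpaths'
  have h01 : (0 : Fin 8) ≠ 1 := by decide
  obtain ⟨i, -, -, ⟨hiv, hiv₁⟩, hiv', hiv₁'⟩ :=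
    exists_pair_avoiding c h01 f (fun i => ⟨(hf i).1, (hf i).2.1⟩) hfd v v v v'
  obtain ⟨j, hji, hji₁, ⟨hjv, hjv₁⟩, hjv', hjv₁'⟩ :=
    exists_pair_avoiding c h01 g (fun i => ⟨(hg i).1, (hg i).2.1⟩) hgd (f i).1 (f i).2 v v'
  obtain ⟨ca, cb, hau, -, hva, hab, hbu⟩ := hf i
  obtain ⟨ca', cb', hau', -, hva', hab', hbu'⟩ := hg j
  generalize (f i).1 = a at *
  generalize (f i).2 = b at *
  generalize (g j).1 = a' at *
  generalize (g j).2 = b' at *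
  simp only [Set.mem_insert_iff, Set.mem_singleton_iff, not_or] at hvne hv'ne
  obtain ⟨hv0, -, hv2⟩ := hvne
  obtain ⟨hv0', -, hv2'⟩ := hv'ne
  have hne : ∀ {s t : V} {p q : Fin 8}, c s = p → c t = q → p ≠ q → s ≠ t := by
    rintro s t p q hs ht hpq rfl
    exact hpq (hs.symm.trans ht)
  have h02 : (0 : Fin 8) ≠ 2 := by decide
  have hbu0 := hne hc0 cb h01
  have hbu0' := hne hc0 cb' h01
  have hau2 := hne ca hc2 h02
  have hau2' := hne ca' hc2 h02
  have haa := hne ca cb' h01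
  have haa' := hne ca' cb h01
  have hu := hdist.2.1
  refine ⟨![u₀, v, a, b, u₂, b', a', v'], ?_, ?_, ⟨1, rfl⟩, ⟨7, rfl⟩⟩
  · rw [← List.nodup_ofFn]
    have hab₁ := hab.ne
    have hab₂ := hab'.ne
    have hb₁ := hbu.ne
    have hb₂ := hbu'.ne
    simp [List.ofFn_succ]
    grind
  · intro k
    fin_cases k
    exacts [hv, hva, hab, hbu, hbu'.symm, hab'.symm, hva'.symm, hv'.symm]
end

section
/- Let G be a finite simple graph with vertex set V, let c : V → {0, 1, …, 9} be a coloring, and let u₀, u₁, …, u₉ be a 10-cycle of G with c(u_i) = i for all i. A 3-path of a vertex x to u₃ is a triple of pairwise distinct vertices (w₀, w₁, w₂) with c(w_j) = j for j = 0, 1, 2, with {w₀, w₁, w₂} disjoint from {u₀, u₁, u₂}, such that x is adjacent to w₀, w₀ is adjacent to w₁, w₁ is adjacent to w₂, and w₂ is adjacent to u₃; two 3-paths are node-disjoint if they share no vertex. Then there do not exist two distinct vertices s ≠ s′, both adjacent to u₀, neither lying on any 10-cycle of G, such that each of s and s′ has at least 10 pairwise node-disjoint 3-paths to u₃. -/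
/-- `s` lies on some 10-cycle of `G`. -/
def OnTenCycle {V : Type*} (G : SimpleGraph V) (s : V) : Prop :=
  ∃ x : Fin 10 → V, Function.Injective x ∧
    (∀ i : Fin 10, G.Adj (x i) (x (i + 1))) ∧ (∃ i, x i = s)

/-- `(w₀, w₁, w₂)` is a 3-path from `x` to `u 3`: pairwise distinct, colored `0,1,2`,
disjoint from `{u 0, u 1, u 2}`, with `x ~ w₀ ~ w₁ ~ w₂ ~ u 3`. -/
def IsThreePath {V : Type*} (G : SimpleGraph V) (c : V → Fin 10)
    (u : Fin 10 → V) (x : V) (p : V × V × V) : Prop :=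
  p.1 ≠ p.2.1 ∧ p.1 ≠ p.2.2 ∧ p.2.1 ≠ p.2.2 ∧
  c p.1 = 0 ∧ c p.2.1 = 1 ∧ c p.2.2 = 2 ∧
  (({p.1, p.2.1, p.2.2} : Set V) ∩ {u 0, u 1, u 2} = ∅) ∧
  G.Adj x p.1 ∧ G.Adj p.1 p.2.1 ∧ G.Adj p.2.1 p.2.2 ∧ G.Adj p.2.2 (u 3)

/-- A pairwise disjoint family of sets indexed by `Fin n` has a member avoiding any given finite
set with fewer than `n` elements. -/
theorem exists_disjoint_of_card_lt {α : Type*} {n : ℕ} (A : Fin n → Set α)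
    (hA : ∀ i j, i ≠ j → A i ∩ A j = ∅) (T : Finset α) (hT : T.card < n) :
    ∃ i, ∀ a ∈ T, a ∉ A i := by
  by_contra! h
  choose t htT htA using h
  obtain ⟨i, -, j, -, hij, heq⟩ := Finset.exists_ne_map_eq_of_card_lt_of_maps_to
    (s := Finset.univ) (by simpa using hT) fun i _ ↦ htT i
  have hmem : t i ∈ A i ∩ A j := ⟨htA i, heq ▸ htA j⟩
  rw [hA i j hij] at hmem
  exact hmem

/-- Ten distinct vertices, cyclically adjacent, put the first of them on a 10-cycle. -/
theorem onTenCycle_of_nodup {V : Type*} {G : SimpleGraph V} {a b c d e f g h k l : V}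
    (hnd : [a, b, c, d, e, f, g, h, k, l].Nodup)
    (hab : G.Adj a b) (hbc : G.Adj b c) (hcd : G.Adj c d) (hde : G.Adj d e) (hef : G.Adj e f)
    (hfg : G.Adj f g) (hgh : G.Adj g h) (hhk : G.Adj h k) (hkl : G.Adj k l) (hla : G.Adj l a) :
    OnTenCycle G a := by
  refine ⟨![a, b, c, d, e, f, g, h, k, l], ?_, ?_, 0, rfl⟩
  · rw [← List.nodup_ofFn]
    simpa [List.ofFn_succ] using hnd
  · intro i
    fin_cases i <;> assumption

/-- There cannot exist two distinct neighbors `s ≠ s′` of `u₀`, neither on any 10-cycle,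
each having at least `10` pairwise node-disjoint 3-paths to `u₃`. -/
theorem no_two_bad_three_path_neighbors {V : Type*} [Fintype V]
    (G : SimpleGraph V) (c : V → Fin 10)
    (u : Fin 10 → V) (hu_inj : Function.Injective u)
    (hu_adj : ∀ i : Fin 10, G.Adj (u i) (u (i + 1)))
    (hu_col : ∀ i : Fin 10, c (u i) = i) :
    ¬ ∃ s s' : V, s ≠ s' ∧ G.Adj (u 0) s ∧ G.Adj (u 0) s' ∧
      ¬ OnTenCycle G s ∧ ¬ OnTenCycle G s' ∧
      (∃ f : Fin 10 → V × V × V, (∀ i, IsThreePath G c u s (f i)) ∧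
        ∀ i j, i ≠ j →
          (({(f i).1, (f i).2.1, (f i).2.2} : Set V) ∩
            {(f j).1, (f j).2.1, (f j).2.2} = ∅)) ∧
      (∃ f : Fin 10 → V × V × V, (∀ i, IsThreePath G c u s' (f i)) ∧
        ∀ i j, i ≠ j →
          (({(f i).1, (f i).2.1, (f i).2.2} : Set V) ∩
            {(f j).1, (f j).2.1, (f j).2.2} = ∅)) := by
  classical
  rintro ⟨s, s', hss, hs, hs', hns, hns', ⟨f, hf, hfd⟩, ⟨g, hg, hgd⟩⟩
  have hsu : ∀ i, u i ≠ s := fun i h ↦ hns ⟨u, hu_inj, hu_adj, i, h⟩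
  have hsu' : ∀ i, u i ≠ s' := fun i h ↦ hns' ⟨u, hu_inj, hu_adj, i, h⟩
  obtain ⟨i, hi⟩ := exists_disjoint_of_card_lt _ hfd {s, s'} (Finset.card_le_two.trans_lt (by simp))
  have hfi := hf i
  obtain ⟨⟨w₀, w₁, w₂⟩, hw⟩ : ∃ w, w = f i := ⟨_, rfl⟩
  rw [← hw] at hi hfi
  obtain ⟨j, hj⟩ := exists_disjoint_of_card_lt _ hgd {s, s', w₀, w₁, w₂}
    (Finset.card_le_five.trans_lt (by simp))
  have hgj := hg j
  obtain ⟨⟨v₀, v₁, v₂⟩, hv⟩ : ∃ v, v = g j := ⟨_, rfl⟩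
  rw [← hv] at hj hgj
  obtain ⟨hw01, hw02, hw12, hcw₀, hcw₁, hcw₂, hwu, haw₀, haw₁, haw₂, haw₃⟩ := hfi
  obtain ⟨hv01, hv02, hv12, hcv₀, hcv₁, hcv₂, hvu, hav₀, hav₁, hav₂, hav₃⟩ := hgj
  have hc3 := hu_col 3
  refine hns (onTenCycle_of_nodup ?_ hs.symm hs' hav₀ hav₁ hav₂ hav₃ haw₃.symm haw₂.symm
    haw₁.symm haw₀.symm)
  have h0 := hsu 0
  have h3 := hsu 3
  have h0' := hsu' 0
  have h3' := hsu' 3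
  have h03 : u 0 ≠ u 3 := hu_inj.ne (by decide)
  have hne : ∀ {x : V} {k : Fin 10}, c x = k → k ≠ 3 → x ≠ u 3 := by
    rintro x k hx hk rfl
    exact hk (hx.symm.trans hc3)
  have e1 := hne hcw₀ (by decide)
  have e2 := hne hcw₁ (by decide)
  have e3 := hne hcw₂ (by decide)
  have e4 := hne hcv₀ (by decide)
  have e5 := hne hcv₁ (by decide)
  have e6 := hne hcv₂ (by decide)
  simp only [Set.eq_empty_iff_forall_notMem, Set.mem_inter_iff, Set.mem_insert_iff,
    Set.mem_singleton_iff] at hwu hvu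
  have hwu0 := hwu (u 0)
  have hvu0 := hvu (u 0)
  simp only [Finset.mem_insert, Finset.mem_singleton, forall_eq_or_imp, forall_eq,
    Set.mem_insert_iff, Set.mem_singleton_iff] at hi hj
  simp only [List.nodup_cons, List.mem_cons, List.not_mem_nil, List.nodup_nil]
  clear hw hv hf hg hfd hgd hwu hvu hne hsu hsu'
  grind
end

section
/- Let k ≥ 3 be an integer and let G be a finite simple graph containing no cycle of length less than k. Suppose u ≠ v are vertices such that G contains a path P₁ from v to u of length ⌊k/2⌋ and a path P₂ from v to u of length ⌈k/2⌉ whose penultimate vertices differ, i.e., the neighbor of u on P₁ is distinct from the neighbor of u on P₂. Then G contains a cycle of length exactly k. -/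
/-- If `G` has no cycle of length less than `k` (`k ≥ 3`) and there are paths from `v`
to `u ≠ v` of lengths `⌊k/2⌋` and `⌈k/2⌉` whose penultimate vertices differ, then `G`
contains a cycle of length exactly `k`. -/
theorem cycle_of_two_paths {V : Type*} [Fintype V]
    (G : SimpleGraph V) (k : ℕ) (hk : 3 ≤ k)
    (hnosmall : ∀ (x : V) (w : G.Walk x x), w.IsCycle → k ≤ w.length)
    (u v : V) (huv : u ≠ v)
    (p₁ p₂ : G.Walk v u)
    (hp₁ : p₁.IsPath) (hp₂ : p₂.IsPath)
    (hl₁ : p₁.length = k / 2) (hl₂ : p₂.length = (k + 1) / 2)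
    (hpen : p₁.getVert (p₁.length - 1) ≠ p₂.getVert (p₂.length - 1)) :
    ∃ (x : V) (w : G.Walk x x), w.IsCycle ∧ w.length = k := by
  have hne : p₁ ≠ p₂ := by
    rintro rfl
    exact hpen rfl
  obtain ⟨x, -, -, c, hc, hle⟩ := hp₁.exists_isCycle_length_le_add_of_ne hp₂ hne
  have hge := hnosmall x c hc
  exact ⟨x, c, hc, by omega⟩
end
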